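/- arXiv:0910.2026 — 4 statements merged into one kernel-verified Lean document; each statement's English description precedes it below -/
import Mathlib

section
/- Classification of precisely monotone sets: Let E ⊆ ℍ be precisely monotone, i.e. for every horizontal line L, both E ∩ L and Eᶜ ∩ L are connected subsets of L. If E ≠ ∅ and E ≠ ℍ, then there exists a half-space 𝒫 ⊆ ℝ³ with ℒ³(E △ 𝒫) = 0. -/
open MeasureTheory Filter

noncomputable section

namespace Heis

/-- The Heisenberg group, as `ℝ³` with the Heisenberg product. -/
abbrev H : Type := ℝ × ℝ × ℝ

/-- The Heisenberg group multiplication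
`(a,b,c)·(a',b',c') = (a+a', b+b', c+c'+ab'−ba')`. -/
def hmul (x y : H) : H :=
  (x.1 + y.1, x.2.1 + y.2.1, x.2.2 + y.2.2 + x.1 * y.2.1 - x.2.1 * y.1)

/-- The Carnot–Carathéodory distance on the Heisenberg group: the infimum of
lengths of horizontal curves from `x` to `y`.  A curve `γ` is horizontal when its
velocity `d t` at `γ t` lies in the tangent plane of the horizontal plane at
`γ t`, i.e. `(d t).2.2 = (γ t).1 * (d t).2.1 - (γ t).2.1 * (d t).1`, and the
left-invariant length of such a velocity is the Euclidean norm of its first two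
components. -/
def dH (x y : H) : ℝ :=
  sInf { l : ℝ | ∃ γ d : ℝ → H,
    γ 0 = x ∧ γ 1 = y ∧
    (∀ t ∈ Set.Icc (0:ℝ) 1, HasDerivWithinAt γ (d t) (Set.Icc (0:ℝ) 1) t) ∧
    (∀ t ∈ Set.Icc (0:ℝ) 1,
      (d t).2.2 = (γ t).1 * (d t).2.1 - (γ t).2.1 * (d t).1) ∧
    l = ∫ t in (0:ℝ)..1, Real.sqrt ((d t).1 ^ 2 + (d t).2.1 ^ 2) }

/-- The open ball for the Carnot–Carathéodory distance. -/
def ball (x : H) (r : ℝ) : Set H := { y : H | dH x y < r }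

/-- The horizontal line through `(a,b,c)` with direction `(u,v)`; it is
arclength-parameterized when `u² + v² = 1`. -/
def hline (a b c u v : ℝ) : ℝ → H :=
  fun t => (a + t * u, b + t * v, c + t * (a * v - b * u))

/-- A horizontal line parameterized by arclength. -/
def IsUnitLine (L : ℝ → H) : Prop :=
  ∃ a b c u v : ℝ, u ^ 2 + v ^ 2 = 1 ∧ L = hline a b c u v

/-- A subset of `ℍ` which is a horizontal line. -/
def IsHLine (ℓ : Set H) : Prop :=
  ∃ a b c u v : ℝ, (u, v) ≠ ((0:ℝ), (0:ℝ)) ∧ ℓ = Set.range (hline a b c u v)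

/-- The projection `π : ℍ → ℝ²`. -/
def proj (x : H) : ℝ × ℝ := (x.1, x.2.1)

/-- Parameterization of the oriented horizontal lines: to `(θ, p, h)` we associate
the horizontal lift at height `h` of the line in `ℝ²` with direction
`(cos θ, sin θ)` and signed distance `p` from the origin. -/
def lineOf (q : ℝ × ℝ × ℝ) : ℝ → H :=
  hline (-q.2.1 * Real.sin q.1) (q.2.1 * Real.cos q.1) q.2.2 (Real.cos q.1) (Real.sin q.1)

/-- The (unnormalized) left-invariant measure on the space of oriented horizontal
lines, in the parameterization `lineOf`. -/
def lineMeas₀ : Measure (ℝ × ℝ × ℝ) :=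
  (volume : Measure (ℝ × ℝ × ℝ)).restrict
    ((Set.Ico (0:ℝ) (2 * Real.pi)) ×ˢ (Set.univ : Set (ℝ × ℝ)))

/-- The parameters of the lines meeting a given subset of `ℍ`. -/
def linesMeeting (U : Set H) : Set (ℝ × ℝ × ℝ) := { q | ∃ t : ℝ, lineOf q t ∈ U }

/-- The left-invariant measure `𝒩` on horizontal lines, normalized so that the
lines meeting `B₁(e)` have measure `1`. -/
def lineMeas : Measure (ℝ × ℝ × ℝ) :=
  (lineMeas₀ (linesMeeting (ball ((0:ℝ), (0:ℝ), (0:ℝ)) 1)))⁻¹ • lineMeas₀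

/-- `ℝ`-valued indicator function of a subset of `ℍ`. -/
def ind (E : Set H) (x : H) : ℝ := Set.indicator E (fun _ => (1:ℝ)) x

/-- The nonconvexity `NC_{B_r(x)}(E, L)` of `E` along the arclength-parameterized
horizontal line `L`, inside the ball `B_r(x)`; the infimum runs over subintervals
(`OrdConnected` subsets) of `L ∩ B_r(x)`, possibly empty. -/
def NCline (E : Set H) (x : H) (r : ℝ) (L : ℝ → H) : ℝ :=
  sInf { v : ℝ | ∃ I : Set ℝ, I.OrdConnected ∧ I ⊆ { t : ℝ | L t ∈ ball x r } ∧
    v = ∫ t in { t : ℝ | L t ∈ ball x r },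
      |Set.indicator I (fun _ => (1:ℝ)) t - ind E (L t)| }

/-- The nonmonotonicity `NM_{B_r(x)}(E, L)`. -/
def NMline (E : Set H) (x : H) (r : ℝ) (L : ℝ → H) : ℝ :=
  NCline E x r L + NCline Eᶜ x r L

/-- Total normalized nonconvexity `NC_{B_r(x)}(E)`. -/
def NCtot (E : Set H) (x : H) (r : ℝ) : ℝ :=
  (1 / r ^ 4) * ∫ q in linesMeeting (ball x r), NCline E x r (lineOf q) ∂lineMeas

/-- Total normalized nonmonotonicity `NM_{B_r(x)}(E)`. -/
def NMtot (E : Set H) (x : H) (r : ℝ) : ℝ :=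
  (1 / r ^ 4) * ∫ q in linesMeeting (ball x r), NMline E x r (lineOf q) ∂lineMeas

/-- `E` is `δ`-monotone on `B_r(x)`. -/
def DeltaMonotone (δ : ℝ) (E : Set H) (x : H) (r : ℝ) : Prop := NMtot E x r < δ

/-- `E` is `δ`-convex on `B_r(x)`. -/
def DeltaConvex (δ : ℝ) (E : Set H) (x : H) (r : ℝ) : Prop := NCtot E x r < δ

/-- The quantitative interior `int_{α,u}(E)`. -/
def qInt (α u : ℝ) (E : Set H) : Set H :=
  { x : H | ENNReal.ofReal (1 - α) * volume (ball x u) ≤ volume (E ∩ ball x u) }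

/-- The quantitative boundary `∂_{α,u}(E)`. -/
def qBdry (α u : ℝ) (E : Set H) : Set H :=
  { x : H | ENNReal.ofReal α * volume (ball x u) < volume (E ∩ ball x u) ∧
      volume (E ∩ ball x u) < ENNReal.ofReal (1 - α) * volume (ball x u) }

/-- Half-spaces in `ℝ³`: points lying on one closed side of an affine 2-plane. -/
def IsHalfSpace (P : Set H) : Prop :=
  ∃ w : ℝ × ℝ × ℝ, ∃ b : ℝ, w ≠ 0 ∧
    P = { x : H | w.1 * x.1 + w.2.1 * x.2.1 + w.2.2 * x.2.2 ≤ b }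

/-- Affine 2-planes in `ℝ³`. -/
def IsPlane (Q : Set H) : Prop :=
  ∃ w : ℝ × ℝ × ℝ, ∃ b : ℝ, w ≠ 0 ∧
    Q = { x : H | w.1 * x.1 + w.2.1 * x.2.1 + w.2.2 * x.2.2 = b }

/-- The pointwise upper Lipschitz constant of `h` at `x` w.r.t. `dH`
(`limsup_{y→x} |h(y)−h(x)|/dH(x,y)`). -/
def pLip (h : H → ℝ) (x : H) : ℝ :=
  sInf { M : ℝ | ∃ ε : ℝ, 0 < ε ∧ ∀ y : H, dH x y < ε → |h y - h x| ≤ M * dH x y }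

/-- `h` is Lipschitz for the Carnot–Carathéodory distance. -/
def LipschitzH (h : H → ℝ) : Prop := ∃ M : ℝ, ∀ x y : H, |h x - h y| ≤ M * dH x y

/-- The perimeter `Per(E)(U)`: the infimum, over sequences of `dH`-Lipschitz
functions converging to `χ_E` in `L¹_loc(U)`, of `liminf ∫_U Lip(h_i)`. -/
def perimeter (E U : Set H) : ℝ :=
  sInf { v : ℝ | ∃ h : ℕ → H → ℝ,
    (∀ i, LipschitzH (h i)) ∧
    (∀ K : Set H, K ⊆ U → IsCompact K →
      Tendsto (fun i => ∫ x in K, |h i x - ind E x|) atTop (nhds 0)) ∧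
    v = liminf (fun i => ∫ x in U, pLip (h i) x) atTop }

/-- The `dH`-distance from a point to a set. -/
def distSetH (x : H) (A : Set H) : ℝ := sInf { d : ℝ | ∃ a ∈ A, d = dH x a }

/-- The closed `ε`-tubular neighborhood of `A ⊆ ℍ`. -/
def tube (ε : ℝ) (A : Set H) : Set H := { x : H | distSetH x A ≤ ε }

/-- The Euclidean distance from a point of `ℝ²` to a subset of `ℝ²`. -/
def dist2 (q : ℝ × ℝ) (A : Set (ℝ × ℝ)) : ℝ :=
  sInf { d : ℝ | ∃ a ∈ A, d = Real.sqrt ((q.1 - a.1) ^ 2 + (q.2 - a.2) ^ 2) }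

/-- Two horizontal lines are skew if they are neither parallel (left translates of
each other) nor intersecting. -/
def Skew (ℓ₁ ℓ₂ : Set H) : Prop :=
  IsHLine ℓ₁ ∧ IsHLine ℓ₂ ∧ ¬ (∃ g : H, ℓ₂ = (hmul g) '' ℓ₁) ∧ ℓ₁ ∩ ℓ₂ = ∅

/-- The rotation `O_θ` of the Heisenberg group. -/
def rot (θ : ℝ) (x : H) : H :=
  (x.1 * Real.cos θ - x.2.1 * Real.sin θ, x.1 * Real.sin θ + x.2.1 * Real.cos θ, x.2.2)

/-- The first line `{(t, wt, c)}` of the normal form of a pair of skew lines. -/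
def nf₁ (w c : ℝ) : Set H := Set.range (fun t : ℝ => ((t, w * t, c) : H))

/-- The second line `{(s, −ws, −c)}` of the normal form of a pair of skew lines. -/
def nf₂ (w c : ℝ) : Set H := Set.range (fun s : ℝ => ((s, -(w * s), -c) : H))

/-- The pair `(ℓ₁, ℓ₂)` has normal-form parameters `(w, c)`: after a left
translation, a rotation, and possibly relabeling, it becomes the normal pair. -/
def HasNormalForm (ℓ₁ ℓ₂ : Set H) (w c : ℝ) : Prop :=
  0 < w ∧ 0 < c ∧ ∃ g : H, ∃ θ : ℝ,
    (((rot θ) ∘ (hmul g)) '' ℓ₁ = nf₁ w c ∧ ((rot θ) ∘ (hmul g)) '' ℓ₂ = nf₂ w c) ∨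
    (((rot θ) ∘ (hmul g)) '' ℓ₁ = nf₂ w c ∧ ((rot θ) ∘ (hmul g)) '' ℓ₂ = nf₁ w c)

/-- The arclength-parameterized horizontal line through `y` with direction angle `θ`. -/
def lineThrough (y : H) (θ : ℝ) : ℝ → H :=
  hline y.1 y.2.1 y.2.2 (Real.cos θ) (Real.sin θ)

/-- The measure `σ_{r,x}` on pairs of points of `B_r(x)` lying on a common coset
of the center: the pushforward of `ℒ³ ⊗ ℒ¹` under `(y,t) ↦ (y, y·(0,0,t))`,
restricted to `B_r(x) × B_r(x)`. -/
def pairMeasure (x : H) (r : ℝ) : Measure (H × H) :=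
  (((volume : Measure H).prod (volume : Measure ℝ)).map
    (fun p : H × ℝ => (p.1, hmul p.1 ((0:ℝ), (0:ℝ), p.2)))).restrict
      ((ball x r) ×ˢ (ball x r))

/-- The metric `ρ` of negative type on `ℝ³`. -/
def rho (p q : H) : ℝ :=
  Real.sqrt (Real.sqrt (((q.1 - p.1) ^ 2 + (q.2.1 - p.2.1) ^ 2) ^ 2 +
      (q.2.2 - p.2.2 + 2 * p.1 * q.2.1 - 2 * p.2.1 * q.1) ^ 2) +
    (q.1 - p.1) ^ 2 + (q.2.1 - p.2.1) ^ 2)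

/-- The grid `{0, 1, …, n}³ ⊆ ℝ³`. -/
def cube (n : ℕ) : Set H :=
  { v : H | ∃ a b k : ℕ, a ≤ n ∧ b ≤ n ∧ k ≤ n ∧ v = ((a:ℝ), (b:ℝ), (k:ℝ)) }

/-- The discrete Heisenberg group `ℍ(ℤ)`, as `ℤ³`. -/
abbrev Hz : Type := ℤ × ℤ × ℤ

/-- The multiplication of the discrete Heisenberg group. -/
def zmul (x y : Hz) : Hz :=
  (x.1 + y.1, x.2.1 + y.2.1, x.2.2 + y.2.2 + x.1 * y.2.1 - x.2.1 * y.1)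

/-- The standard generating set `T` of `ℍ(ℤ)`. -/
def genSet : Set Hz :=
  {((1:ℤ), (0:ℤ), (0:ℤ)), (-1, 0, 0), (0, 1, 0), (0, -1, 0), (0, 0, 1), (0, 0, -1)}

/-- The word metric `d_T` on `ℍ(ℤ)` w.r.t. the generating set `T`. -/
def dT (x y : Hz) : ℕ :=
  sInf { n : ℕ | ∃ w : List Hz, (∀ g ∈ w, g ∈ genSet) ∧ w.length = n ∧
    w.foldl zmul x = y }

/-- The Euclidean norm on `ℝ³`. -/
def norm3 (v : H) : ℝ := Real.sqrt (v.1 ^ 2 + v.2.1 ^ 2 + v.2.2 ^ 2)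

/-- A rotation-invariant measure on directions, obtained by pushing the Lebesgue
measure of the annulus `1 ≤ |v| ≤ 2` forward under radial projection. -/
def sphereMeasure : Measure H :=
  ((volume : Measure H).restrict { v : H | 1 ≤ norm3 v ∧ norm3 v ≤ 2 }).map
    (fun v : H => (((norm3 v)⁻¹ * v.1, (norm3 v)⁻¹ * v.2.1, (norm3 v)⁻¹ * v.2.2) : H))

/-- The affine line in `ℝ³` with direction `v` through the point `(ab.1, ab.2, 0)`,
parameterized by `t` (Euclidean arclength when `|v| = 1`). -/
def lineDir (v : H) (ab : ℝ × ℝ) : ℝ → H :=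
  fun t => (ab.1 + t * v.1, ab.2 + t * v.2.1, t * v.2.2)

/-- The kinematic measure on affine lines of `ℝ³` transverse to the horizontal
plane, in the parameterization `lineDir` by a unit direction `v` and a base point
in the plane `z = 0`; the density `|v₃|` converts Lebesgue measure on `z = 0` into
Lebesgue measure on the plane orthogonal to the direction. -/
def kinMeas : Measure (H × (ℝ × ℝ)) :=
  (sphereMeasure.prod (volume : Measure (ℝ × ℝ))).withDensity
    (fun q => ENNReal.ofReal |q.1.2.2|)


open Topology

/-- The antisymmetric function whose zero set `{y | pol x y = 0}` is the horizontal plane at `x`. -/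
def pol (x y : H) : ℝ := y.2.2 - x.2.2 - x.1 * y.2.1 + x.2.1 * y.1

/-- The horizontal line through `p` whose projection to the plane has direction `d`. -/
def lineFrom (p : H) (d : ℝ × ℝ) (t : ℝ) : H :=
  (p.1 + t * d.1, p.2.1 + t * d.2, p.2.2 + t * (p.1 * d.2 - p.2.1 * d.1))

/-- Convexity along horizontal segments. -/
def HConvex (K : Set H) : Prop :=
  ∀ x y, pol x y = 0 → x ∈ K → y ∈ K → ∀ t ∈ Set.Icc (0 : ℝ) 1, x + t • (y - x) ∈ K

/-- Both the set and its complement are convex along horizontal segments. -/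
def HMono (E : Set H) : Prop := HConvex E ∧ HConvex Eᶜ

theorem HMono.compl {E : Set H} (hE : HMono E) : HMono Eᶜ :=
  ⟨hE.2, by rw [compl_compl]; exact hE.1⟩

theorem pol_swap (x y : H) : pol y x = -pol x y := by
  simp only [pol]; ring

theorem pol_self (x : H) : pol x x = 0 := by
  simp only [pol]; ring

theorem pol_swap_eq_zero {x y : H} (h : pol x y = 0) : pol y x = 0 := by
  rw [pol_swap, h, neg_zero]

theorem pol_add_smul_sub (x y z : H) (t : ℝ) :
    pol x (y + t • (z - y)) = (1 - t) * pol x y + t * pol x z := by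
  simp only [pol, Prod.fst_add, Prod.snd_add, Prod.smul_fst, Prod.smul_snd, Prod.fst_sub,
    Prod.snd_sub, smul_eq_mul]
  ring

theorem pol_lineFrom (p : H) (d : ℝ × ℝ) (s t : ℝ) :
    pol (lineFrom p d s) (lineFrom p d t) = 0 := by
  simp only [pol, lineFrom]; ring

theorem lineFrom_zero (p : H) (d : ℝ × ℝ) : lineFrom p d 0 = p := by
  ext <;> simp [lineFrom]

theorem lineFrom_neg (p : H) (d : ℝ × ℝ) (t : ℝ) : lineFrom p (-d) t = lineFrom p d (-t) := by
  ext <;> simp only [lineFrom, Prod.fst_neg, Prod.snd_neg] <;> ring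

theorem lineFrom_eq_add_smul_sub {p y : H} (h : pol p y = 0) (t : ℝ) :
    lineFrom p (y.1 - p.1, y.2.1 - p.2.1) t = p + t • (y - p) := by
  simp only [pol] at h
  ext <;> simp only [lineFrom, Prod.fst_add, Prod.snd_add, Prod.smul_fst, Prod.smul_snd,
    Prod.fst_sub, Prod.snd_sub, smul_eq_mul]
  linear_combination -t * h

@[fun_prop]
theorem continuous_pol : Continuous fun z : H × H => pol z.1 z.2 := by
  unfold pol; fun_prop

@[fun_prop]
theorem continuous_lineFrom :
    Continuous fun z : H × (ℝ × ℝ) × ℝ => lineFrom z.1 z.2.1 z.2.2 := by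
  unfold lineFrom; fun_prop

theorem HConvex.lineFrom_mem {K : Set H} (hK : HConvex K) {p : H} {d : ℝ × ℝ} {r s t : ℝ}
    (hrs : r ≤ s) (hst : s ≤ t) (hr : lineFrom p d r ∈ K) (ht : lineFrom p d t ∈ K) :
    lineFrom p d s ∈ K := by
  rcases eq_or_lt_of_le (hrs.trans hst) with h | h
  · have : s = r := le_antisymm (h ▸ hst) hrs
    rwa [this]
  · have h0 : 0 < t - r := sub_pos.2 h
    convert hK _ _ (pol_lineFrom p d r t) hr ht ((s - r) / (t - r))
      ⟨div_nonneg (by linarith) h0.le, (div_le_one h0).2 (by linarith)⟩ using 1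
    have h1 : (s - r) / (t - r) * (t - r) = s - r := div_mul_cancel₀ _ h0.ne'
    ext <;> simp only [lineFrom, Prod.fst_add, Prod.snd_add, Prod.smul_fst, Prod.smul_snd,
      Prod.fst_sub, Prod.snd_sub, smul_eq_mul]
    · linear_combination (-d.1) * h1
    · linear_combination (-d.2) * h1
    · linear_combination (-(p.1 * d.2 - p.2.1 * d.1)) * h1

theorem mem_interior_or_of_notMem_frontier {E : Set H} {x : H} (hx : x ∉ frontier E) :
    x ∈ interior E ∨ x ∈ interior Eᶜ := by
  by_contra! h
  exact hx ⟨by simpa [interior_compl] using h.2, h.1⟩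

theorem mem_closure_compl_of_mem_frontier {E : Set H} {x : H} (hx : x ∈ frontier E) :
    x ∈ closure Eᶜ :=
  frontier_subset_closure (frontier_compl E ▸ hx)

theorem eventually_lineFrom_mem {K : Set H} {p : H} {d : ℝ × ℝ} {t : ℝ}
    (h : lineFrom p d t ∈ interior K) : ∀ᶠ p' in 𝓝 p, lineFrom p' d t ∈ K := by
  have hc : Continuous fun p' : H => lineFrom p' d t := by fun_prop
  exact (hc.tendsto p).eventually (mem_interior_iff_mem_nhds.1 h)

theorem HConvex.mem_interior {K : Set H} (hK : HConvex K) {p : H} {d : ℝ × ℝ} {s t : ℝ}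
    (hs : s < 0) (ht : 0 < t) (hs' : lineFrom p d s ∈ interior K)
    (ht' : lineFrom p d t ∈ interior K) : p ∈ interior K := by
  rw [mem_interior_iff_mem_nhds]
  filter_upwards [eventually_lineFrom_mem hs', eventually_lineFrom_mem ht'] with p' h1 h2
  simpa [lineFrom_zero] using hK.lineFrom_mem hs.le ht.le h1 h2

theorem HConvex.notMem_closure {K : Set H} (hK : HConvex K) {p : H} {d : ℝ × ℝ} {s t : ℝ}
    (hs : 0 < s) (hst : s < t) (hs' : lineFrom p d s ∈ interior Kᶜ)
    (ht' : lineFrom p d t ∈ interior K) : p ∉ closure K := by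
  intro hp
  obtain ⟨p', hp', h1, h2⟩ := ((mem_closure_iff_frequently.1 hp).and_eventually
    ((eventually_lineFrom_mem hs').and (eventually_lineFrom_mem ht'))).exists
  exact h1 (hK.lineFrom_mem hs.le hst.le ((lineFrom_zero p' d).symm ▸ hp') h2)

/-- Directions of the horizontal rays from `p` which meet the interior of `K`. -/
def raysMeeting (K : Set H) (p : H) : Set (ℝ × ℝ) := {d | ∃ t > 0, lineFrom p d t ∈ interior K}

theorem isOpen_raysMeeting (K : Set H) (p : H) : IsOpen (raysMeeting K p) := by
  have : raysMeeting K p = ⋃ t ∈ Set.Ioi (0 : ℝ), {d | lineFrom p d t ∈ interior K} := by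
    ext d; simp [raysMeeting]
  rw [this]
  refine isOpen_biUnion fun t _ => isOpen_interior.preimage ?_
  fun_prop

theorem HMono.neg_notMem_raysMeeting {E : Set H} (hE : HMono E) {p : H} (hp : p ∈ frontier E)
    {d : ℝ × ℝ} (hd : d ∈ raysMeeting E p) : -d ∉ raysMeeting E p := by
  rintro ⟨s, hs, hs'⟩
  obtain ⟨t, ht, ht'⟩ := hd
  rw [lineFrom_neg] at hs'
  exact hp.2 (hE.1.mem_interior (neg_neg_of_pos hs) ht hs' ht')

theorem HMono.notMem_raysMeeting_compl {E : Set H} (hE : HMono E) {p : H} (hp : p ∈ frontier E)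
    {d : ℝ × ℝ} (hd : d ∈ raysMeeting E p) : d ∉ raysMeeting Eᶜ p := by
  rintro ⟨s, hs, hs'⟩
  obtain ⟨t, ht, ht'⟩ := hd
  rcases lt_trichotomy s t with h | h | h
  · exact hE.1.notMem_closure hs h hs' ht' hp.1
  · subst h
    exact interior_subset hs' (interior_subset ht')
  · exact hE.2.notMem_closure ht h (by rwa [compl_compl]) hs'
      (mem_closure_compl_of_mem_frontier hp)

theorem HMono.exists_lineFrom_mem_frontier {E : Set H} (hE : HMono E) {p : H}
    (hp : p ∈ frontier E) : ∃ d : ℝ × ℝ, d ≠ 0 ∧ ∀ t, lineFrom p d t ∈ frontier E := by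
  by_contra! hcon
  let D : ℝ → ℝ × ℝ := fun θ => (Real.cos θ, Real.sin θ)
  have hD : Continuous D := by fun_prop
  have hD0 : ∀ θ, D θ ≠ 0 := by
    intro θ h
    have h1 : Real.cos θ = 0 := congrArg Prod.fst h
    have h2 : Real.sin θ = 0 := congrArg Prod.snd h
    have := Real.cos_sq_add_sin_sq θ
    rw [h1, h2] at this
    norm_num at this
  have hDpi : ∀ θ, D (θ + Real.pi) = -D θ := by
    intro θ; ext <;> simp [D, Real.cos_add_pi, Real.sin_add_pi]
  have hp' : p ∈ frontier Eᶜ := by rwa [frontier_compl]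
  let A : Set ℝ := {θ | D θ ∈ raysMeeting E p ∨ -D θ ∈ raysMeeting Eᶜ p}
  let B : Set ℝ := {θ | -D θ ∈ raysMeeting E p ∨ D θ ∈ raysMeeting Eᶜ p}
  have hA : IsOpen A := ((isOpen_raysMeeting E p).preimage hD).union
    ((isOpen_raysMeeting Eᶜ p).preimage hD.neg)
  have hB : IsOpen B := ((isOpen_raysMeeting E p).preimage hD.neg).union
    ((isOpen_raysMeeting Eᶜ p).preimage hD)
  have hAB : ∀ θ, θ ∈ A ∨ θ ∈ B := by
    intro θ
    obtain ⟨t, ht⟩ := hcon (D θ) (hD0 θ)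
    rcases lt_trichotomy t 0 with h | h | h
    · have h2 : lineFrom p (D θ) t = lineFrom p (-D θ) (-t) := by rw [lineFrom_neg, neg_neg]
      rw [h2] at ht
      rcases mem_interior_or_of_notMem_frontier ht with h1 | h1
      · exact Or.inr (Or.inl ⟨-t, neg_pos.2 h, h1⟩)
      · exact Or.inl (Or.inr ⟨-t, neg_pos.2 h, h1⟩)
    · subst h
      exact absurd ((lineFrom_zero p _).symm ▸ hp) ht
    · rcases mem_interior_or_of_notMem_frontier ht with h1 | h1
      · exact Or.inl (Or.inl ⟨t, h, h1⟩)
      · exact Or.inr (Or.inr ⟨t, h, h1⟩)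
  have hpiA : ∀ θ ∈ A, θ + Real.pi ∈ B := by
    rintro θ (h | h)
    · exact Or.inl (by rwa [hDpi, neg_neg])
    · exact Or.inr (by rwa [hDpi])
  have hpiB : ∀ θ ∈ B, θ + Real.pi ∈ A := by
    rintro θ (h | h)
    · exact Or.inl (by rwa [hDpi])
    · exact Or.inr (by rwa [hDpi, neg_neg])
  have hne : A.Nonempty ∧ B.Nonempty := by
    rcases hAB 0 with h | h
    · exact ⟨⟨0, h⟩, ⟨_, hpiA 0 h⟩⟩
    · exact ⟨⟨_, hpiB 0 h⟩, ⟨0, h⟩⟩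
  obtain ⟨θ, -, hθA, hθB⟩ := isPreconnected_univ (α := ℝ) A B hA hB (fun θ _ => hAB θ)
    (by simpa using hne.1) (by simpa using hne.2)
  rcases hθA with h | h <;> rcases hθB with h' | h'
  · exact hE.neg_notMem_raysMeeting hp h h'
  · exact hE.notMem_raysMeeting_compl hp h h'
  · exact hE.notMem_raysMeeting_compl hp h' h
  · exact hE.compl.neg_notMem_raysMeeting hp' h' h

theorem HConvex.exists_pol_eq_zero {K : Set H} (hK : HConvex K) {a b c : H} {U : Set H}
    (hU : Convex ℝ U) (hab : pol a b = 0) (ha : a ∈ K) (hb : b ∈ K) (haU : a ∈ U) (hbU : b ∈ U)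
    (hca : 0 < pol c a) (hcb : pol c b < 0) : ∃ x ∈ U, x ∈ K ∧ pol c x = 0 := by
  have h0 : 0 < pol c a - pol c b := by linarith
  have ht : pol c a / (pol c a - pol c b) ∈ Set.Icc (0 : ℝ) 1 :=
    ⟨div_nonneg hca.le h0.le, (div_le_one h0).2 (by linarith)⟩
  refine ⟨_, hU.add_smul_sub_mem haU hbU ht, hK a b hab ha hb _ ht, ?_⟩
  rw [pol_add_smul_sub]
  field_simp
  ring

theorem HMono.eventually_exists_pol_eq_zero_of_axis {K : Set H} (hK : HMono K)
    (hax : ∀ s : ℝ, ((0, s, 0) : H) ∈ closure K) {U : Set H} (hU : U ∈ 𝓝 (0 : H)) :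
    ∀ᶠ c in 𝓝 ((1, 0, 0) : H), ∃ a ∈ U, a ∈ K ∧ pol c a = 0 := by
  obtain ⟨δ, hδ, hδU⟩ := Metric.mem_nhds_iff.1 hU
  obtain ⟨ε, hε, hεδ⟩ : ∃ ε > 0, 4 * ε = δ := ⟨δ / 4, by positivity, by ring⟩
  let b : H × H → H := fun z =>
    let x := (z.2.2.2 - z.1.2.2 - 2 * ε * (z.2.1 - z.1.1)) / (z.2.2.1 - z.1.2.1)
    (x, -2 * ε, z.1.2.2 - 2 * ε * z.1.1 - z.1.2.1 * x)
  let q : H × H → H := fun z => z.1 + (2 : ℝ) • (z.1 - b z)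
  let z₀ : H × H := ((0, -ε, 0), (0, ε, 0))
  have hbz : b z₀ = (0, -2 * ε, 0) := by simp [b, z₀]
  have hqz : q z₀ = (0, ε, 0) := by
    simp only [q, hbz, z₀]
    ext <;> simp
    ring
  have hbc : ContinuousAt b z₀ := by
    have hden : z₀.2.2.1 - z₀.1.2.1 ≠ 0 := by simp only [z₀]; linarith
    have hx : ContinuousAt (fun z : H × H =>
        (z.2.2.2 - z.1.2.2 - 2 * ε * (z.2.1 - z.1.1)) / (z.2.2.1 - z.1.2.1)) z₀ :=
      ContinuousAt.div (by fun_prop) (by fun_prop) hden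
    exact hx.prodMk (continuousAt_const.prodMk
      (ContinuousAt.sub (by fun_prop) (ContinuousAt.mul (by fun_prop) hx)))
  have hqc : ContinuousAt q z₀ := by
    simp only [q]
    fun_prop
  have hball : ∀ s : ℝ, |s| < δ → Metric.ball (0 : H) δ ∈ 𝓝 ((0, s, 0) : H) := by
    intro s hs
    refine Metric.isOpen_ball.mem_nhds ?_
    simp [Prod.norm_def, hs]
  have habs : |ε| < δ := by rw [abs_of_pos hε]; linarith
  have hpol : ∀ s : ℝ, pol (1, 0, 0) (0, s, 0) = -s := by intro s; simp [pol]
  have key : ∀ g : H × H → H, ContinuousAt g z₀ → ContinuousAt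
      (fun z : H × H × H => pol z.1 (g z.2)) ((1, 0, 0), z₀) := by
    intro g hg
    have h1 : ContinuousAt (fun z : H × H × H => (z.1, g z.2)) ((1, 0, 0), z₀) :=
      continuousAt_fst.prodMk (ContinuousAt.comp (f := Prod.snd) (g := g) hg continuousAt_snd)
    exact ContinuousAt.comp (g := fun z : H × H => pol z.1 z.2) continuous_pol.continuousAt h1
  have ev : ∀ᶠ z : H × H × H in 𝓝 ((1, 0, 0), z₀),
      (z.2.1 ∈ Metric.ball (0 : H) δ ∧ z.2.2 ∈ Metric.ball (0 : H) δ ∧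
        b z.2 ∈ Metric.ball (0 : H) δ ∧ q z.2 ∈ Metric.ball (0 : H) δ) ∧
      0 < pol z.1 z.2.1 ∧ 0 < pol z.1 (b z.2) ∧ pol z.1 z.2.2 < 0 ∧ pol z.1 (q z.2) < 0 ∧
      0 < z.2.2.2.1 - z.2.1.2.1 := by
    have hsnd : Tendsto (fun z : H × H × H => z.2) (𝓝 ((1, 0, 0), z₀)) (𝓝 z₀) :=
      continuousAt_snd
    have e1 : ∀ᶠ z in 𝓝 z₀, z.1 ∈ Metric.ball (0 : H) δ :=
      continuousAt_fst.eventually_mem (hball (-ε) (by rwa [abs_neg]))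
    have e2 : ∀ᶠ z in 𝓝 z₀, z.2 ∈ Metric.ball (0 : H) δ :=
      continuousAt_snd.eventually_mem (hball ε habs)
    have e3 : ∀ᶠ z in 𝓝 z₀, b z ∈ Metric.ball (0 : H) δ :=
      hbc.eventually_mem (by
        rw [hbz]; refine hball _ ?_; rw [abs_lt]; constructor <;> linarith)
    have e4 : ∀ᶠ z in 𝓝 z₀, q z ∈ Metric.ball (0 : H) δ :=
      hqc.eventually_mem (by rw [hqz]; exact hball ε habs)
    have p1 : ∀ᶠ z : H × H × H in 𝓝 ((1, 0, 0), z₀), 0 < pol z.1 z.2.1 := by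
      refine (key Prod.fst continuousAt_fst).eventually (lt_mem_nhds (a := 0) ?_)
      change 0 < pol (1, 0, 0) (0, -ε, 0)
      rw [hpol]; linarith
    have p2 : ∀ᶠ z : H × H × H in 𝓝 ((1, 0, 0), z₀), 0 < pol z.1 (b z.2) := by
      refine (key b hbc).eventually (lt_mem_nhds (a := 0) ?_)
      change 0 < pol (1, 0, 0) (b z₀)
      rw [hbz, hpol]; linarith
    have p3 : ∀ᶠ z : H × H × H in 𝓝 ((1, 0, 0), z₀), pol z.1 z.2.2 < 0 := by
      refine (key Prod.snd continuousAt_snd).eventually (gt_mem_nhds (a := 0) ?_)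
      change pol (1, 0, 0) (0, ε, 0) < 0
      rw [hpol]; linarith
    have p4 : ∀ᶠ z : H × H × H in 𝓝 ((1, 0, 0), z₀), pol z.1 (q z.2) < 0 := by
      refine (key q hqc).eventually (gt_mem_nhds (a := 0) ?_)
      change pol (1, 0, 0) (q z₀) < 0
      rw [hqz, hpol]; linarith
    have p5 : ∀ᶠ z : H × H in 𝓝 z₀, 0 < z.2.2.1 - z.1.2.1 := by
      have hc : ContinuousAt (fun z : H × H => z.2.2.1 - z.1.2.1) z₀ := by fun_prop
      exact hc.eventually (lt_mem_nhds (a := 0) (by simp only [z₀]; linarith))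
    filter_upwards [hsnd.eventually e1, hsnd.eventually e2, hsnd.eventually e3,
      hsnd.eventually e4, p1, p2, p3, p4, hsnd.eventually p5] with z h1 h2 h3 h4 h5 h6 h7 h8 h9
    exact ⟨⟨h1, h2, h3, h4⟩, h5, h6, h7, h8, h9⟩
  filter_upwards [ev.curry_nhds] with c hc
  obtain ⟨k₁, hk₁, hc₁⟩ :=
    ((mem_closure_iff_frequently.1 (hax (-ε))).and_eventually hc.curry_nhds).exists
  obtain ⟨k₂, hk₂, ⟨h1, h2, h3, h4⟩, p1, p2, p3, p4, p5⟩ :=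
    ((mem_closure_iff_frequently.1 (hax ε)).and_eventually hc₁).exists
  have hb₁ : pol k₁ (b (k₁, k₂)) = 0 := by simp only [pol, b]; ring
  have hb₂ : pol k₂ (b (k₁, k₂)) = 0 := by
    simp only at p5
    simp only [pol, b]
    field_simp
    ring
  have hq : q (k₁, k₂) = k₁ + (-2 : ℝ) • (b (k₁, k₂) - k₁) := by
    simp only [q]; module
  have hfin : ∃ a ∈ Metric.ball (0 : H) δ, a ∈ K ∧ pol c a = 0 := by
    by_cases hqK : q (k₁, k₂) ∈ K
    · refine hK.1.exists_pol_eq_zero (convex_ball 0 δ) ?_ hk₁ hqK h1 h4 p1 p4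
      rw [hq, pol_add_smul_sub, pol_self, hb₁]; ring
    · have hbK : b (k₁, k₂) ∈ K := by
        by_contra hbK
        have h5 : pol (b (k₁, k₂)) (q (k₁, k₂)) = 0 := by
          rw [hq, pol_add_smul_sub, pol_self, pol_swap, hb₁]; ring
        refine hK.2 _ _ h5 hbK hqK (1 / 3) ⟨by norm_num, by norm_num⟩ ?_ |>.elim
        convert! hk₁ using 1
        rw [hq]; module
      exact hK.1.exists_pol_eq_zero (convex_ball 0 δ) (pol_swap_eq_zero hb₂) hbK hk₂ h3 h2 p2 p3
  obtain ⟨a, ha, ha'⟩ := hfin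
  exact ⟨a, hδU ha, ha'⟩

/-- The affine coordinates centred at `p` whose first two axes are the horizontal lines through `p`
with directions `d` and `e`. -/
def frame (p : H) (d e : ℝ × ℝ) (x : H) : H :=
  (p.1 + x.1 * d.1 + x.2.1 * e.1, p.2.1 + x.1 * d.2 + x.2.1 * e.2,
    p.2.2 + x.1 * (p.1 * d.2 - p.2.1 * d.1) + x.2.1 * (p.1 * e.2 - p.2.1 * e.1) +
      (d.1 * e.2 - d.2 * e.1) * x.2.2)

theorem pol_frame (p : H) (d e : ℝ × ℝ) (x y : H) :
    pol (frame p d e x) (frame p d e y) = (d.1 * e.2 - d.2 * e.1) * pol x y := by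
  simp only [pol, frame]; ring

theorem frame_add_smul_sub (p : H) (d e : ℝ × ℝ) (x y : H) (t : ℝ) :
    frame p d e (x + t • (y - x)) = frame p d e x + t • (frame p d e y - frame p d e x) := by
  ext <;> simp [frame] <;> ring

theorem frame_zero (p : H) (d e : ℝ × ℝ) : frame p d e 0 = p := by
  ext <;> simp [frame]

theorem frame_fst (p : H) (d e : ℝ × ℝ) (s : ℝ) : frame p d e (s, 0, 0) = lineFrom p d s := by
  ext <;> simp [frame, lineFrom]

theorem frame_snd (p : H) (d e : ℝ × ℝ) (s : ℝ) : frame p d e (0, s, 0) = lineFrom p e s := by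
  ext <;> simp [frame, lineFrom]

/-- `frame` as a homeomorphism. -/
def frameHomeo (p : H) (d e : ℝ × ℝ) (h : d.1 * e.2 - d.2 * e.1 ≠ 0) : H ≃ₜ H where
  toFun := frame p d e
  invFun y :=
    let u := ((y.1 - p.1) * e.2 - (y.2.1 - p.2.1) * e.1) / (d.1 * e.2 - d.2 * e.1)
    let v := (d.1 * (y.2.1 - p.2.1) - d.2 * (y.1 - p.1)) / (d.1 * e.2 - d.2 * e.1)
    (u, v, (y.2.2 - p.2.2 - u * (p.1 * d.2 - p.2.1 * d.1) - v * (p.1 * e.2 - p.2.1 * e.1)) /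
      (d.1 * e.2 - d.2 * e.1))
  left_inv x := by
    have hu : ((frame p d e x).1 - p.1) * e.2 - ((frame p d e x).2.1 - p.2.1) * e.1 =
        x.1 * (d.1 * e.2 - d.2 * e.1) := by simp only [frame]; ring
    have hv : d.1 * ((frame p d e x).2.1 - p.2.1) - d.2 * ((frame p d e x).1 - p.1) =
        x.2.1 * (d.1 * e.2 - d.2 * e.1) := by simp only [frame]; ring
    simp only [hu, hv, mul_div_cancel_right₀ _ h]
    ext
    · rfl
    · rfl
    · simp only [frame]
      rw [div_eq_iff h]
      ring
  right_inv y := by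
    have hu := div_mul_cancel₀ ((y.1 - p.1) * e.2 - (y.2.1 - p.2.1) * e.1) h
    have hv := div_mul_cancel₀ (d.1 * (y.2.1 - p.2.1) - d.2 * (y.1 - p.1)) h
    ext <;> simp only [frame]
    · exact mul_right_cancel₀ h (by linear_combination d.1 * hu + e.1 * hv)
    · exact mul_right_cancel₀ h (by linear_combination d.2 * hu + e.2 * hv)
    · rw [mul_div_cancel₀ _ h]; ring
  continuous_toFun := by unfold frame; fun_prop
  continuous_invFun := by fun_prop

theorem frameHomeo_apply (p : H) (d e : ℝ × ℝ) (h : d.1 * e.2 - d.2 * e.1 ≠ 0) (x : H) :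
    frameHomeo p d e h x = frame p d e x := rfl

theorem HConvex.preimage_frame {K : Set H} (hK : HConvex K) (p : H) (d e : ℝ × ℝ) :
    HConvex (frame p d e ⁻¹' K) := by
  intro x y hxy hx hy t ht
  simp only [Set.mem_preimage, frame_add_smul_sub]
  exact hK _ _ (by rw [pol_frame, hxy, mul_zero]) hx hy t ht

theorem HMono.preimage_frame {K : Set H} (hK : HMono K) (p : H) (d e : ℝ × ℝ) :
    HMono (frame p d e ⁻¹' K) :=
  ⟨hK.1.preimage_frame p d e, hK.2.preimage_frame p d e⟩

theorem HMono.eventually_exists_pol_eq_zero {K : Set H} (hK : HMono K) {p : H} {d e : ℝ × ℝ}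
    (hde : d.1 * e.2 - d.2 * e.1 ≠ 0) (he : ∀ s, lineFrom p e s ∈ closure K) {U : Set H}
    (hU : U ∈ 𝓝 p) : ∀ᶠ c in 𝓝 (lineFrom p d 1), ∃ a ∈ U, a ∈ K ∧ pol c a = 0 := by
  let φ := frameHomeo p d e hde
  have h0 : φ ⁻¹' U ∈ 𝓝 (0 : H) :=
    φ.continuous.continuousAt.preimage_mem_nhds
      (by rwa [frameHomeo_apply, frame_zero])
  have hcl : ∀ s : ℝ, ((0, s, 0) : H) ∈ closure (frame p d e ⁻¹' K) := by
    intro s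
    have h1 := φ.preimage_closure K
    have h2 : ((0, s, 0) : H) ∈ φ ⁻¹' closure K := by
      rw [Set.mem_preimage, frameHomeo_apply, frame_snd]
      exact he s
    rwa [h1] at h2
  have h1 := (hK.preimage_frame p d e).eventually_exists_pol_eq_zero_of_axis hcl h0
  have h2 : φ.symm (lineFrom p d 1) = (1, 0, 0) := by
    rw [Homeomorph.symm_apply_eq, frameHomeo_apply, frame_fst]
  rw [← h2] at h1
  filter_upwards [φ.symm.continuous.continuousAt.eventually h1] with c hc
  obtain ⟨a, haU, haK, ha⟩ := hc
  refine ⟨φ a, haU, haK, ?_⟩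
  rw [← φ.apply_symm_apply c, frameHomeo_apply, frameHomeo_apply, pol_frame, ha, mul_zero]

theorem HConvex.add_smul_sub_mem_of_one_lt {K : Set H} (hK : HConvex Kᶜ) {a c : H} {t : ℝ}
    (hac : pol a c = 0) (ha : a ∉ K) (ht : 1 < t) (hc : c ∈ K) : a + t • (c - a) ∈ K := by
  by_contra hx
  have hpol : pol a (a + t • (c - a)) = 0 := by rw [pol_add_smul_sub, pol_self, hac]; ring
  refine hK a _ hpol ha hx (1 / t) ⟨by positivity, (div_le_one (by linarith)).2 ht.le⟩ ?_
  rw [add_sub_cancel_left, smul_smul, one_div_mul_cancel (by linarith), one_smul,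
    add_sub_cancel]
  exact hc

theorem HMono.exists_pol_eq_zero_add_smul_mem {E K C : Set H} (hE : HMono E) (hK : HMono K)
    {p y : H} (hp : p ∈ frontier E) (hKE : frontier E ⊆ closure K) (hy : y ∈ closure C)
    (hpy : pol p y = 0) {t : ℝ} (hx : p + t • (y - p) ∈ interior E) :
    (∀ s : ℝ, p + s • (y - p) ∈ frontier E) ∨
      ∃ a ∈ K, ∃ c ∈ C, pol a c = 0 ∧ a + t • (c - a) ∈ E := by
  obtain ⟨e, he0, he⟩ := hE.exists_lineFrom_mem_frontier hp
  by_cases hde : (y.1 - p.1) * e.2 - (y.2.1 - p.2.1) * e.1 = 0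
  · left
    intro s
    rw [← lineFrom_eq_add_smul_sub hpy]
    have hsq : e.1 ^ 2 + e.2 ^ 2 ≠ 0 := by
      contrapose! he0
      ext
      · exact pow_eq_zero_iff two_ne_zero |>.1 (by nlinarith [sq_nonneg e.1, sq_nonneg e.2])
      · exact pow_eq_zero_iff two_ne_zero |>.1 (by nlinarith [sq_nonneg e.1, sq_nonneg e.2])
    convert! he (s * ((y.1 - p.1) * e.1 + (y.2.1 - p.2.1) * e.2) / (e.1 ^ 2 + e.2 ^ 2)) using 1
    ext <;> simp only [lineFrom] <;> field_simp
    · linear_combination s * e.2 * hde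
    · linear_combination -s * e.1 * hde
    · linear_combination (-s * p.1 * e.1 - s * p.2.1 * e.2) * hde
  · right
    have hcont : Continuous fun z : H × H => z.1 + t • (z.2 - z.1) := by fun_prop
    have h1 : ∀ᶠ z : H × H in 𝓝 p ×ˢ 𝓝 y, z.1 + t • (z.2 - z.1) ∈ E := by
      rw [← nhds_prod_eq]
      exact (hcont.tendsto (p, y)).eventually (mem_interior_iff_mem_nhds.1 hx)
    obtain ⟨U, hU, V, hV, hUV⟩ := Filter.eventually_prod_iff.1 h1
    have h2 := hK.eventually_exists_pol_eq_zero (d := (y.1 - p.1, y.2.1 - p.2.1)) hde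
      (fun s => hKE (he s)) hU
    rw [lineFrom_eq_add_smul_sub hpy, one_smul, add_sub_cancel] at h2
    obtain ⟨c, hcC, ⟨a, haU, haK, hca⟩, hcV⟩ :=
      ((mem_closure_iff_frequently.1 hy).and_eventually (h2.and hV)).exists
    exact ⟨a, haK, c, hcC, pol_swap_eq_zero hca, hUV haU hcV⟩

theorem HMono.notMem_interior {E : Set H} (hE : HMono E) {p y : H} (hp : p ∈ frontier E)
    (hy : y ∈ frontier E) (hpy : pol p y = 0) (t : ℝ) : p + t • (y - p) ∉ interior E := by
  intro hx
  have hE' : frontier E ⊆ closure E := frontier_subset_closure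
  have hEc : frontier E ⊆ closure Eᶜ := fun z => mem_closure_compl_of_mem_frontier
  have hno : ¬ ∀ s : ℝ, p + s • (y - p) ∈ frontier E := fun h => (h t).2 hx
  rcases lt_trichotomy t 0 with h | h | h
  · obtain ⟨a, ha, c, hc, hac, hm⟩ :=
      (hE.exists_pol_eq_zero_add_smul_mem hE.compl hp hEc (hE' hy) hpy hx).resolve_left hno
    have h1 : 0 < 1 - t := by linarith
    refine ha ?_
    have h2 : pol c (a + t • (c - a)) = 0 := by
      rw [pol_add_smul_sub, pol_self, pol_swap_eq_zero hac]; ring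
    convert! hE.1 c _ h2 hc hm (1 / (1 - t)) ⟨by positivity, (div_le_one h1).2 (by linarith)⟩
      using 1
    have h3 : a + t • (c - a) - c = (1 - t) • (a - c) := by module
    rw [h3, smul_smul, one_div_mul_cancel h1.ne', one_smul, add_sub_cancel]
  · subst h
    rw [zero_smul, add_zero] at hx
    exact hp.2 hx
  rcases lt_trichotomy t 1 with h' | h' | h'
  · obtain ⟨a, ha, c, hc, hac, hm⟩ :=
      (hE.exists_pol_eq_zero_add_smul_mem hE.compl hp hEc (hEc hy) hpy hx).resolve_left hno
    exact hE.2 a c hac ha hc t ⟨h.le, h'.le⟩ hm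
  · subst h'
    rw [one_smul, add_sub_cancel] at hx
    exact hy.2 hx
  · obtain ⟨a, ha, c, hc, hac, hm⟩ :=
      (hE.exists_pol_eq_zero_add_smul_mem hE hp hE' (hEc hy) hpy hx).resolve_left hno
    have hE2 : HConvex Eᶜᶜ := hE.compl.2
    exact hE2.add_smul_sub_mem_of_one_lt hac (fun h => h ha) h' hc hm

/-- Sets closed under joining related points by horizontal lines. -/
def JoinClosed (S : Set H) : Prop :=
  ∀ x ∈ S, ∀ y ∈ S, pol x y = 0 → ∀ t : ℝ, x + t • (y - x) ∈ S

theorem HMono.joinClosed_frontier {E : Set H} (hE : HMono E) : JoinClosed (frontier E) := by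
  intro p hp y hy hpy t
  by_contra hx
  rcases mem_interior_or_of_notMem_frontier hx with h | h
  · exact hE.notMem_interior hp hy hpy t h
  · rw [← frontier_compl] at hp hy
    exact hE.compl.notMem_interior hp hy hpy t h

theorem HMono.exists_pol_eq_zero_of_dense {K : Set H} (hK : HMono K) (hd : Dense K) {c p : H}
    (hcp : pol c p = 0) (hne : c ≠ p) {U : Set H} (hU : U ∈ 𝓝 p) :
    ∃ a ∈ U, a ∈ K ∧ pol c a = 0 := by
  have hpc := pol_swap_eq_zero hcp
  have hde : (c.1 - p.1) * (c.1 - p.1) - (c.2.1 - p.2.1) * -(c.2.1 - p.2.1) ≠ 0 := by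
    contrapose! hne
    have h1 : c.1 - p.1 = 0 := by
      nlinarith [sq_nonneg (c.1 - p.1), sq_nonneg (c.2.1 - p.2.1)]
    have h2 : c.2.1 - p.2.1 = 0 := by
      nlinarith [sq_nonneg (c.1 - p.1), sq_nonneg (c.2.1 - p.2.1)]
    simp only [pol] at hpc
    ext
    · linarith
    · linarith
    · linear_combination hpc + p.1 * h2 - p.2.1 * h1
  have h := (hK.eventually_exists_pol_eq_zero (d := (c.1 - p.1, c.2.1 - p.2.1))
    (e := (-(c.2.1 - p.2.1), c.1 - p.1)) hde (fun s => hd _) hU).self_of_nhds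
  rwa [lineFrom_eq_add_smul_sub hpc, one_smul, add_sub_cancel] at h

theorem HMono.exists_mem_inter_of_dense {K : Set H} (hK : HMono K) (hd : Dense K) {c c' y : H}
    (hcK : c ∈ K) (hcy : pol c y = 0) (hcy' : pol c' y = 0) (hcc : pol c' c ≠ 0) {U : Set H}
    (hU : U ∈ 𝓝 y) : ∃ a ∈ U, a ∈ K ∧ pol c a = 0 ∧ pol c' a = 0 := by
  have hne : c ≠ y := by rintro rfl; exact hcc hcy'
  let z : H := c + (2 : ℝ) • (y - c)
  let θ : H → ℝ := fun a => pol c' c / (pol c' c - pol c' a)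
  have hz' : pol c' z = -pol c' c := by simp only [z, pol_add_smul_sub, hcy']; ring
  have hz : pol c z = 0 := by simp only [z, pol_add_smul_sub, hcy, pol_self]; ring
  have hcz : c ≠ z := by
    rintro h
    rw [← h] at hz'
    exact hcc (by linarith)
  have hθz : θ z = 1 / 2 := by
    simp only [θ, hz']
    field_simp
    norm_num
  have hpc : Continuous (pol c') := by unfold pol; fun_prop
  have hθ : ContinuousAt θ z := by
    refine ContinuousAt.div continuousAt_const (by fun_prop) ?_
    rw [hz']
    contrapose! hcc
    linarith
  have hg : ContinuousAt (fun a => c + θ a • (a - c)) z := by fun_prop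
  have hgz : c + θ z • (z - c) = y := by
    rw [hθz]; simp only [z]; module
  have hne0 : ∀ᶠ a in 𝓝 z, pol c' c - pol c' a ≠ 0 := by
    have hc0 : ContinuousAt (fun a => pol c' c - pol c' a) z := by fun_prop
    refine hc0.eventually_ne ?_
    rw [hz']
    contrapose! hcc
    linarith
  have hgU : ∀ᶠ a in 𝓝 z, c + θ a • (a - c) ∈ U := hg.eventually_mem (by rwa [hgz])
  have hev := hgU.and
    ((hθ.eventually (Icc_mem_nhds (a := 0) (b := 1) (by rw [hθz]; norm_num)
      (by rw [hθz]; norm_num))).and hne0)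
  obtain ⟨a, ⟨haU, haθ, ha0⟩, haK, hca⟩ := hK.exists_pol_eq_zero_of_dense hd hz hcz hev
  refine ⟨_, haU, hK.1 c a hca hcK haK _ haθ, ?_, ?_⟩
  · rw [pol_add_smul_sub, pol_self, hca]; ring
  · rw [pol_add_smul_sub]
    simp only [θ]
    field_simp
    ring

theorem pol_add_smul_sub_left (x y z : H) (t : ℝ) :
    pol (y + t • (z - y)) x = (1 - t) * pol y x + t * pol z x := by
  rw [pol_swap, pol_add_smul_sub, pol_swap y x, pol_swap z x]; ring

/-- The transversal `fg` of the edges `x₁x₂` and `y₁y₂` of a tetrahedron meets the quadric ruled by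
the horizontal segments joining the edges `x₁y₁` and `x₂y₂`. -/
theorem HConvex.tetrahedron_aux {K : Set H} (hK : HConvex K) (hK' : HConvex Kᶜ)
    {x₁ x₂ y₁ y₂ : H} (hx₁ : x₁ ∈ K) (hx₂ : x₂ ∈ K) (hy₁ : y₁ ∈ K) (hy₂ : y₂ ∈ K)
    (h11 : pol x₁ y₁ = 0) (h12 : pol x₁ y₂ = 0) (h21 : pol x₂ y₁ = 0) (h22 : pol x₂ y₂ = 0)
    {σ ρ : ℝ} (hσ : σ ∈ Set.Ioo (0 : ℝ) 1) (hρ : ρ ∈ Set.Ioo (0 : ℝ) 1)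
    (hf : x₁ + σ • (x₂ - x₁) ∉ K) (hg : y₁ + ρ • (y₂ - y₁) ∉ K)
    (hneg : pol x₁ x₂ * pol y₁ y₂ < 0) : False := by
  obtain ⟨hσ0, hσ1⟩ := hσ
  obtain ⟨hρ0, hρ1⟩ := hρ
  have hσ2 : 0 < 1 - σ := by linarith
  have hρ2 : 0 < 1 - ρ := by linarith
  have hx : pol x₁ x₂ ≠ 0 := left_ne_zero_of_mul hneg.ne
  have hM : 0 < -(pol x₁ x₂ * pol y₁ y₂) := by linarith
  obtain ⟨r, hr, hr2⟩ : ∃ r > 0,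
      r ^ 2 * (σ * (1 - σ)) * (pol x₁ x₂) ^ 2 = -(pol x₁ x₂ * pol y₁ y₂) * (ρ * (1 - ρ)) := by
    refine ⟨√(-(pol x₁ x₂ * pol y₁ y₂) * (ρ * (1 - ρ)) / (σ * (1 - σ) * (pol x₁ x₂) ^ 2)),
      by positivity, ?_⟩
    rw [Real.sq_sqrt (by positivity)]
    field_simp
  have hr3 : r ^ 2 * (σ * (1 - σ)) * pol x₁ x₂ + pol y₁ y₂ * (ρ * (1 - ρ)) = 0 :=
    mul_left_cancel₀ hx (by linear_combination hr2)
  let s := (1 - ρ) / (r * (1 - σ) + (1 - ρ))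
  let s' := r * σ / (r * σ + ρ)
  let θ := (r * σ + ρ) / (1 + r)
  let κ := 1 / (1 + r)
  have hd1 : 0 < r * (1 - σ) + (1 - ρ) := by positivity
  have hd2 : 0 < r * σ + ρ := by positivity
  have hs : s ∈ Set.Icc (0 : ℝ) 1 :=
    ⟨by positivity, (div_le_one hd1).2 (by nlinarith)⟩
  have hs' : s' ∈ Set.Icc (0 : ℝ) 1 :=
    ⟨by positivity, (div_le_one hd2).2 (by nlinarith)⟩
  have hθ : θ ∈ Set.Icc (0 : ℝ) 1 :=
    ⟨by positivity, (div_le_one (by positivity)).2 (by nlinarith)⟩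
  have hκ : κ ∈ Set.Icc (0 : ℝ) 1 :=
    ⟨by positivity, (div_le_one (by positivity)).2 (by linarith)⟩
  have hl := hK x₁ y₁ h11 hx₁ hy₁ s hs
  have hm := hK y₂ x₂ (pol_swap_eq_zero h22) hy₂ hx₂ s' hs'
  have hlm : pol (x₁ + s • (y₁ - x₁)) (y₂ + s' • (x₂ - y₂)) = 0 := by
    rw [pol_add_smul_sub, pol_add_smul_sub_left, pol_add_smul_sub_left, h12,
      pol_swap_eq_zero h21]
    simp only [s, s']
    field_simp
    linear_combination hr3
  have hin := hK _ _ hlm hl hm θ hθ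
  have hfg : pol (x₁ + σ • (x₂ - x₁)) (y₁ + ρ • (y₂ - y₁)) = 0 := by
    rw [pol_add_smul_sub, pol_add_smul_sub_left, pol_add_smul_sub_left, h11, h12, h21, h22]
    ring
  have hout := hK' _ _ hfg hf hg κ hκ
  apply hout
  convert! hin using 1
  have c1 : (1 - κ) * (1 - σ) = (1 - θ) * (1 - s) := by
    simp only [κ, θ, s]; field_simp; ring
  have c2 : (1 - κ) * σ = θ * s' := by
    simp only [κ, θ, s']; field_simp; ring
  have c3 : κ * (1 - ρ) = (1 - θ) * s := by
    simp only [κ, θ, s]; field_simp; ring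
  have c4 : κ * ρ = θ * (1 - s') := by
    simp only [κ, θ, s']; field_simp; ring
  have e1 : x₁ + σ • (x₂ - x₁) + κ • (y₁ + ρ • (y₂ - y₁) - (x₁ + σ • (x₂ - x₁))) =
      ((1 - κ) * (1 - σ)) • x₁ + ((1 - κ) * σ) • x₂ + (κ * (1 - ρ)) • y₁ + (κ * ρ) • y₂ := by
    module
  have e2 : x₁ + s • (y₁ - x₁) + θ • (y₂ + s' • (x₂ - y₂) - (x₁ + s • (y₁ - x₁))) =
      ((1 - θ) * (1 - s)) • x₁ + (θ * s') • x₂ + ((1 - θ) * s) • y₁ + (θ * (1 - s')) • y₂ := by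
    module
  rw [e1, e2, c1, c2, c3, c4]

theorem HConvex.tetrahedron {K : Set H} (hK : HConvex K) (hK' : HConvex Kᶜ)
    {x₁ x₂ y₁ y₂ : H} (hx₁ : x₁ ∈ K) (hx₂ : x₂ ∈ K) (hy₁ : y₁ ∈ K) (hy₂ : y₂ ∈ K)
    (h11 : pol x₁ y₁ = 0) (h12 : pol x₁ y₂ = 0) (h21 : pol x₂ y₁ = 0) (h22 : pol x₂ y₂ = 0)
    {σ ρ : ℝ} (hσ : σ ∈ Set.Ioo (0 : ℝ) 1) (hρ : ρ ∈ Set.Ioo (0 : ℝ) 1)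
    (hf : x₁ + σ • (x₂ - x₁) ∉ K) (hg : y₁ + ρ • (y₂ - y₁) ∉ K) : False := by
  have hx : pol x₁ x₂ ≠ 0 := fun h => hf (hK _ _ h hx₁ hx₂ σ ⟨hσ.1.le, hσ.2.le⟩)
  have hy : pol y₁ y₂ ≠ 0 := fun h => hg (hK _ _ h hy₁ hy₂ ρ ⟨hρ.1.le, hρ.2.le⟩)
  rcases lt_or_gt_of_ne (mul_ne_zero hx hy) with h | h
  · exact hK.tetrahedron_aux hK' hx₁ hx₂ hy₁ hy₂ h11 h12 h21 h22 hσ hρ hf hg h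
  · refine hK.tetrahedron_aux hK' hx₁ hx₂ hy₂ hy₁ h12 h11 h22 h21 hσ (ρ := 1 - ρ)
      ⟨by linarith [hρ.2], by linarith [hρ.1]⟩ hf ?_ (by rw [pol_swap y₁ y₂]; linarith)
    convert! hg using 2
    module

theorem HMono.false_of_dense {E : Set H} (hE : HMono E) (hd : Dense E) (hd' : Dense Eᶜ)
    (h0 : (0 : H) ∈ E) (h1 : ((1, 0, 1) : H) ∉ E) : False := by
  have hnear : ∀ (i : ℝ) (w : ℝ × ℝ), {a : H | |a.1 - i| < 1 / 2} ∈ 𝓝 ((i, w) : H) := by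
    intro i w
    refine IsOpen.mem_nhds ?_ (by simp)
    exact isOpen_lt (by fun_prop) continuous_const
  have hl : ∀ a : H, pol 0 a = 0 → pol (1, 0, 1) a = 0 → a = (a.1, -1, 0) := by
    intro a h h'
    simp only [pol, Prod.fst_zero, Prod.snd_zero] at h h'
    ext
    · rfl
    · simp; linarith
    · simp; linarith
  have hE1 : ∀ i : ℝ, ∃ u : ℝ, |u - i| < 1 / 2 ∧ ((u, -1, 0) : H) ∈ E := by
    intro i
    obtain ⟨a, ha, haE, h, h'⟩ := hE.exists_mem_inter_of_dense hd (c' := (1, 0, 1)) h0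
      (y := (i, -1, 0)) (by simp [pol]) (by simp [pol]) (by simp [pol]) (hnear i _)
    exact ⟨a.1, ha, hl a h h' ▸ haE⟩
  have hF1 : ∀ i : ℝ, ∃ u : ℝ, |u - i| < 1 / 2 ∧ ((u, -1, 0) : H) ∉ E := by
    intro i
    obtain ⟨a, ha, haE, h, h'⟩ := hE.compl.exists_mem_inter_of_dense hd' (c' := 0) h1
      (y := (i, -1, 0)) (by simp [pol]) (by simp [pol]) (by simp [pol]) (hnear i _)
    exact ⟨a.1, ha, hl a h' h ▸ haE⟩
  have hm : ∀ u v : ℝ, u ≠ v → ∀ a : H, pol (u, -1, 0) a = 0 → pol (v, -1, 0) a = 0 →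
      a = (a.1, 0, a.1) := by
    intro u v huv a h h'
    simp only [pol] at h h'
    have h3 : a.2.1 = 0 := by
      have : (u - v) * a.2.1 = 0 := by linear_combination h' - h
      exact (mul_eq_zero.1 this).resolve_left (sub_ne_zero.2 huv)
    ext
    · rfl
    · exact h3
    · rw [h3] at h
      simp; linarith
  obtain ⟨u₀, hu₀, hu₀E⟩ := hE1 0
  obtain ⟨u₁, hu₁, hu₁E⟩ := hF1 1
  obtain ⟨u₂, hu₂, hu₂E⟩ := hE1 2
  rw [abs_lt] at hu₀ hu₁ hu₂
  have hpol : ∀ u v : ℝ, pol ((u, -1, 0) : H) (v, -1, 0) = u - v := by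
    intro u v; simp [pol]; ring
  have hpol' : ∀ u v : ℝ, pol ((u, -1, 0) : H) (v, 0, v) = 0 := by
    intro u v; simp [pol]
  have hE2 : ∀ i : ℝ, ∃ u : ℝ, |u - i| < 1 / 2 ∧ ((u, 0, u) : H) ∈ E := by
    intro i
    obtain ⟨a, ha, haE, h, h'⟩ := hE.exists_mem_inter_of_dense hd (c' := (u₂, -1, 0)) hu₀E
      (y := (i, 0, i)) (hpol' _ _) (hpol' _ _) (by rw [hpol]; linarith) (hnear i _)
    exact ⟨a.1, ha, hm u₀ u₂ (by linarith) a h h' ▸ haE⟩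
  have hF2 : ∀ i : ℝ, ∃ u : ℝ, |u - i| < 1 / 2 ∧ ((u, 0, u) : H) ∉ E := by
    intro i
    obtain ⟨a, ha, haE, h, h'⟩ := hE.compl.exists_mem_inter_of_dense hd' (c' := (u₂, -1, 0)) hu₁E
      (y := (i, 0, i)) (hpol' _ _) (hpol' _ _) (by rw [hpol]; linarith) (hnear i _)
    exact ⟨a.1, ha, hm u₁ u₂ (by linarith) a h h' ▸ haE⟩
  obtain ⟨v₀, hv₀, hv₀E⟩ := hE2 0
  obtain ⟨v₁, hv₁, hv₁E⟩ := hF2 1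
  obtain ⟨v₂, hv₂, hv₂E⟩ := hE2 2
  rw [abs_lt] at hv₀ hv₁ hv₂
  have hu : 0 < u₂ - u₀ := by linarith
  have hv : 0 < v₂ - v₀ := by linarith
  refine hE.1.tetrahedron hE.2 hu₀E hu₂E hv₀E hv₂E (hpol' _ _) (hpol' _ _) (hpol' _ _) (hpol' _ _)
    (σ := (u₁ - u₀) / (u₂ - u₀)) (ρ := (v₁ - v₀) / (v₂ - v₀))
    ⟨div_pos (by linarith) hu, (div_lt_one hu).2 (by linarith)⟩
    ⟨div_pos (by linarith) hv, (div_lt_one hv).2 (by linarith)⟩ ?_ ?_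
  · convert! hu₁E using 2
    ext <;> simp
    field_simp
    ring
  · convert! hv₁E using 2
    ext <;> simp <;> field_simp <;> ring

theorem HMono.frontier_ne_univ {E : Set H} (hE : HMono E) (hne : E.Nonempty) :
    frontier E ≠ Set.univ := by
  intro hS
  have hd : Dense E := fun x => frontier_subset_closure (hS ▸ Set.mem_univ x)
  have hd' : Dense Eᶜ := fun x => mem_closure_compl_of_mem_frontier (hS ▸ Set.mem_univ x)
  obtain ⟨p, hp⟩ := hne
  have hopen : IsOpen {c : H | pol p c ≠ 0 ∧ c.1 ≠ p.1} := by
    have hpc : Continuous (pol p) := by unfold pol; fun_prop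
    exact (isOpen_ne_fun hpc continuous_const).inter
      (isOpen_ne_fun continuous_fst continuous_const)
  obtain ⟨c, hcE, hpc, hc1⟩ := hd'.exists_mem_open hopen
    ⟨(p.1 + 1, p.2.1, p.2.2 - p.2.1 + 1), by simp [pol]; ring_nf; norm_num, by simp⟩
  have hd1 : c.1 - p.1 ≠ 0 := sub_ne_zero.2 hc1
  have hsq : (c.1 - p.1) ^ 2 + (c.2.1 - p.2.1) ^ 2 ≠ 0 := by positivity
  obtain ⟨d, hd_eq⟩ : ∃ d : ℝ × ℝ, d = (c.1 - p.1, c.2.1 - p.2.1) := ⟨_, rfl⟩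
  obtain ⟨e, he_eq⟩ : ∃ e : ℝ × ℝ, e =
      (-(pol p c / ((c.1 - p.1) ^ 2 + (c.2.1 - p.2.1) ^ 2) * (c.2.1 - p.2.1)),
        pol p c / ((c.1 - p.1) ^ 2 + (c.2.1 - p.2.1) ^ 2) * (c.1 - p.1)) := ⟨_, rfl⟩
  have hdet : d.1 * e.2 - d.2 * e.1 = pol p c := by
    rw [hd_eq, he_eq]; field_simp; ring
  have hdet0 : d.1 * e.2 - d.2 * e.1 ≠ 0 := by rwa [hdet]
  let φ := frameHomeo p d e hdet0
  refine (hE.preimage_frame p d e).false_of_dense (hd.preimage φ.isOpenMap)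
    (hd'.preimage φ.isOpenMap) ?_ ?_
  · rwa [Set.mem_preimage, frame_zero]
  · rw [Set.mem_preimage]
    convert! hcE using 2
    simp only [frame, hdet]
    rw [hd_eq]
    ext <;> simp [pol]
    ring

theorem mem_of_forall_notMem_finite {S : Set H} (hS : IsClosed S) {f : ℝ → H} (hf : Continuous f)
    {T : Set ℝ} (hT : T.Finite) (h : ∀ x ∉ T, f x ∈ S) (x : ℝ) : f x ∈ S :=
  closure_minimal (s := Tᶜ) h (hS.preimage hf) (hT.countable.dense_compl ℝ x)

/-- A closed join-closed set containing the first two axes and a point related to `(1, 0, 0)` off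
the plane they span contains the lines obtained by joining with horizontal transversals. -/
theorem JoinClosed.transversal_mem {S : Set H} (hJ : JoinClosed S)
    (hx : ∀ s : ℝ, ((s, 0, 0) : H) ∈ S) (hy : ∀ s : ℝ, ((0, s, 0) : H) ∈ S) {k : ℝ}
    (hk : ∀ r : ℝ, ((1 + k * r, r, r) : H) ∈ S) {s t : ℝ} (hs : s ≠ 0) (h1 : 1 + k * s ≠ 0)
    (h2 : 2 * t - 1 + k * s * t ≠ 0) (v : ℝ) :
    ((t + (2 * t * (t - 1) / s + k * t ^ 2) * v, v, t * v) : H) ∈ S := by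
  obtain ⟨w, hw⟩ : ∃ w, w = 1 + k * s := ⟨_, rfl⟩
  obtain ⟨g, hg⟩ : ∃ g, g = 2 * t - 1 + k * s * t := ⟨_, rfl⟩
  rw [← hw] at h1
  rw [← hg] at h2
  have hj : ((t / g, -s / g, -t * s / g) : H) ∈ S := by
    convert! hJ _ (hy s) _ (hk (-s / w)) (by
      simp only [pol]; field_simp; rw [hw]; ring) (t * w / g) using 1
    ext <;> simp <;> field_simp <;> simp only [hg, hw] <;> ring
  convert! hJ _ (hx t) _ hj (by simp only [pol]; field_simp; ring) (-v * g / s) using 1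
  ext <;> simp <;> field_simp
  rw [hg]
  ring

theorem JoinClosed.eq_univ_of_axes {S : Set H} (hJ : JoinClosed S) (hS : IsClosed S)
    (hx : ∀ s : ℝ, ((s, 0, 0) : H) ∈ S) (hy : ∀ s : ℝ, ((0, s, 0) : H) ∈ S) {a b : ℝ}
    (hb : b ≠ 0) (hq : ((a, b, b) : H) ∈ S) : S = Set.univ := by
  obtain ⟨k, hk_eq⟩ : ∃ k, k = (a - 1) / b := ⟨_, rfl⟩
  have hk : ∀ r : ℝ, ((1 + k * r, r, r) : H) ∈ S := by
    intro r
    convert! hJ _ (hx 1) _ hq (by simp [pol]) (r / b) using 1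
    rw [hk_eq]
    ext <;> simp <;> field_simp
  have hα : ∀ t : ℝ, t ∉ ({0, 1 / 2, 1} : Set ℝ) → ∀ v α : ℝ,
      ((t + α * v, v, t * v) : H) ∈ S := by
    intro t ht v
    simp only [Set.mem_insert_iff, Set.mem_singleton_iff, not_or] at ht
    obtain ⟨ht0, ht2, ht1⟩ := ht
    have ht1' : t - 1 ≠ 0 := sub_ne_zero.2 ht1
    have ht2' : 2 * t - 1 ≠ 0 := fun h => ht2 (by linarith)
    refine mem_of_forall_notMem_finite hS (by fun_prop) (T := {k * t ^ 2,
      k * t ^ 2 - 2 * k * t * (t - 1), k * t ^ 2 - 2 * k * t ^ 2 * (t - 1) / (2 * t - 1)})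
      (Set.toFinite _) fun α h => ?_
    simp only [Set.mem_insert_iff, Set.mem_singleton_iff, not_or] at h
    obtain ⟨h0, h1, h2⟩ := h
    obtain ⟨D, hD_eq⟩ : ∃ D, D = α - k * t ^ 2 := ⟨_, rfl⟩
    have hD : D ≠ 0 := by rw [hD_eq]; exact sub_ne_zero.2 h0
    convert! hJ.transversal_mem hx hy hk (s := 2 * t * (t - 1) / D) (t := t) ?_ ?_ ?_ v using 4
    · field_simp
      rw [hD_eq]
      ring
    · positivity
    · contrapose! h1
      field_simp at h1
      linear_combination h1 - hD_eq
    · contrapose! h2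
      field_simp at h2
      rw [eq_sub_iff_add_eq, ← eq_sub_iff_add_eq', div_eq_iff ht2']
      linear_combination h2 - (2 * t - 1) * hD_eq
  have ht : ∀ v α t : ℝ, ((t + α * v, v, t * v) : H) ∈ S := fun v α =>
    mem_of_forall_notMem_finite hS (by fun_prop) (Set.toFinite _) fun t h => hα t h v α
  have hY : ∀ x z y : ℝ, ((x, y, z) : H) ∈ S := fun x z =>
    mem_of_forall_notMem_finite hS (by fun_prop) (Set.toFinite {0}) fun y h => by
      have hy0 : y ≠ 0 := h
      convert! ht y ((x - z / y) / y) (z / y) using 1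
      ext <;> field_simp
      ring
  exact Set.eq_univ_of_forall fun x => hY x.1 x.2.2 x.2.1

theorem JoinClosed.preimage_frame {S : Set H} (hJ : JoinClosed S) (p : H) (d e : ℝ × ℝ) :
    JoinClosed (frame p d e ⁻¹' S) := by
  intro x hx y hy hxy t
  rw [Set.mem_preimage, frame_add_smul_sub]
  exact hJ _ hx _ hy (by rw [pol_frame, hxy, mul_zero]) t

theorem pol_lineFrom_left (p q : H) (d : ℝ × ℝ) (t : ℝ) :
    pol (lineFrom p d t) q = pol p q + t * (d.2 * (q.1 - p.1) - d.1 * (q.2.1 - p.2.1)) := by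
  simp only [pol, lineFrom]; ring

theorem JoinClosed.eq_univ {S : Set H} (hJ : JoinClosed S) (hS : IsClosed S) {p q : H}
    {d e : ℝ × ℝ} (hde : d.1 * e.2 - d.2 * e.1 ≠ 0) (hd : ∀ t, lineFrom p d t ∈ S)
    (he : ∀ t, lineFrom p e t ∈ S) (hq : q ∈ S) (hpq : pol p q ≠ 0)
    (hqd : d.2 * (q.1 - p.1) - d.1 * (q.2.1 - p.2.1) ≠ 0) : S = Set.univ := by
  obtain ⟨τ, hτ⟩ : ∃ τ, τ = -pol p q / (d.2 * (q.1 - p.1) - d.1 * (q.2.1 - p.2.1)) := ⟨_, rfl⟩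
  have hτ0 : τ ≠ 0 := by rw [hτ]; exact div_ne_zero (neg_ne_zero.2 hpq) hqd
  have hdet : (τ • d).1 * e.2 - (τ • d).2 * e.1 ≠ 0 := by
    convert! mul_ne_zero hτ0 hde using 1
    simp; ring
  let φ := frameHomeo p (τ • d) e hdet
  have hφ : φ (φ.symm q) = q := φ.apply_symm_apply q
  have hline : ∀ s, lineFrom p (τ • d) s = lineFrom p d (s * τ) := by
    intro s; ext <;> simp [lineFrom] <;> ring
  have h1 : pol 0 (φ.symm q) ≠ 0 := by
    intro h
    apply hpq
    rw [← hφ, ← frame_zero p (τ • d) e, frameHomeo_apply, pol_frame, h, mul_zero]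
  have h2 : pol (1, 0, 0) (φ.symm q) = 0 := by
    refine (mul_eq_zero.1 ?_).resolve_left hdet
    rw [← pol_frame p, ← frameHomeo_apply p (τ • d) e hdet (φ.symm q), hφ, frame_fst, hline,
      pol_lineFrom_left, hτ, one_mul, div_mul_cancel₀ _ hqd, add_neg_cancel]
  have h3 : (φ.symm q).2.2 = (φ.symm q).2.1 := by
    simp only [pol] at h2; linarith
  have h4 : (φ.symm q).2.1 ≠ 0 := by
    rw [← h3]; simpa [pol] using h1
  have h5 := (hJ.preimage_frame p (τ • d) e).eq_univ_of_axes (hS.preimage φ.continuous)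
    (fun s => by rw [Set.mem_preimage, frame_fst, hline]; exact hd _)
    (fun s => by rw [Set.mem_preimage, frame_snd]; exact he _) (a := (φ.symm q).1) h4
    (by
      have h6 : (((φ.symm q).1, (φ.symm q).2.1, (φ.symm q).2.1) : H) = φ.symm q := by
        ext
        · rfl
        · rfl
        · exact h3.symm
      rw [h6, Set.mem_preimage, ← frameHomeo_apply p (τ • d) e hdet, hφ]
      exact hq)
  refine Set.eq_univ_of_forall fun x => ?_
  have h6 : φ.symm x ∈ frame p (τ • d) e ⁻¹' S := h5 ▸ Set.mem_univ _
  rwa [Set.mem_preimage, ← frameHomeo_apply p (τ • d) e hdet, φ.apply_symm_apply] at h6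

theorem eq_zero_of_det_eq_zero {d e : ℝ × ℝ} (hde : d.1 * e.2 - d.2 * e.1 ≠ 0) {x y : ℝ}
    (hd : d.2 * x - d.1 * y = 0) (he : e.2 * x - e.1 * y = 0) : x = 0 ∧ y = 0 :=
  ⟨mul_left_cancel₀ hde (by linear_combination d.1 * he - e.1 * hd),
    mul_left_cancel₀ hde (by linear_combination d.2 * he - e.2 * hd)⟩

theorem JoinClosed.subset_plane {S : Set H} (hJ : JoinClosed S) (hS : IsClosed S)
    (hne : S.Nonempty) (hline : ∀ p ∈ S, ∃ d : ℝ × ℝ, d ≠ 0 ∧ ∀ t, lineFrom p d t ∈ S)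
    (huniv : S ≠ Set.univ) :
    ∃ w : H, w ≠ 0 ∧ ∃ b, ∀ x ∈ S, w.1 * x.1 + w.2.1 * x.2.1 + w.2.2 * x.2.2 = b := by
  obtain ⟨p₀, hp₀⟩ := hne
  obtain ⟨d, hd0, hd⟩ := hline p₀ hp₀
  by_cases h : ∃ q ∈ S, d.2 * (q.1 - p₀.1) - d.1 * (q.2.1 - p₀.2.1) ≠ 0
  swap
  · push Not at h
    refine ⟨(d.2, -d.1, 0), ?_, d.2 * p₀.1 - d.1 * p₀.2.1, fun x hx => ?_⟩
    · contrapose! hd0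
      simp only [Prod.mk_eq_zero, neg_eq_zero] at hd0
      exact Prod.ext hd0.2.1 hd0.1
    · linear_combination h x hx
  obtain ⟨q, hq, hqd⟩ := h
  obtain ⟨τ, hτ⟩ : ∃ τ, τ = -pol p₀ q / (d.2 * (q.1 - p₀.1) - d.1 * (q.2.1 - p₀.2.1)) := ⟨_, rfl⟩
  obtain ⟨p, hp⟩ : ∃ p, p = lineFrom p₀ d τ := ⟨_, rfl⟩
  have hpq : pol p q = 0 := by
    rw [hp, pol_lineFrom_left, hτ, div_mul_cancel₀ _ hqd, add_neg_cancel]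
  have hpS : p ∈ S := hp ▸ hd τ
  obtain ⟨e, he_eq⟩ : ∃ e : ℝ × ℝ, e = (q.1 - p.1, q.2.1 - p.2.1) := ⟨_, rfl⟩
  have he : ∀ t, lineFrom p e t ∈ S := by
    intro t
    rw [he_eq, lineFrom_eq_add_smul_sub hpq]
    exact hJ p hpS q hq hpq t
  have hd' : ∀ t, lineFrom p d t ∈ S := by
    intro t
    convert! hd (τ + t) using 1
    rw [hp]
    ext <;> simp only [lineFrom] <;> ring
  have hde : d.1 * e.2 - d.2 * e.1 ≠ 0 := by
    convert! neg_ne_zero.2 hqd using 1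
    simp only [he_eq, hp, lineFrom]
    ring
  have hed : e.1 * d.2 - e.2 * d.1 ≠ 0 := by
    convert! neg_ne_zero.2 hde using 1
    ring
  refine ⟨(p.2.1, -p.1, 1), by simp, p.2.2, fun x hx => ?_⟩
  suffices h : pol p x = 0 by
    simp only [pol] at h
    linear_combination h
  by_contra hpx
  obtain ⟨y, hy, hpy, hxy⟩ : ∃ y ∈ S, pol p y ≠ 0 ∧ ¬ (y.1 - p.1 = 0 ∧ y.2.1 - p.2.1 = 0) := by
    by_cases hxp : x.1 - p.1 = 0 ∧ x.2.1 - p.2.1 = 0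
    · obtain ⟨f, hf0, hf⟩ := hline x hx
      have hx1 : x.1 = p.1 := sub_eq_zero.1 hxp.1
      have hx2 : x.2.1 = p.2.1 := sub_eq_zero.1 hxp.2
      refine ⟨lineFrom x f 1, hf 1, ?_, fun h => hf0 ?_⟩
      · convert! hpx using 1
        simp only [pol, lineFrom, hx1, hx2]
        ring
      · simp only [lineFrom, hx1, hx2] at h
        ext
        · simpa using h.1
        · simpa using h.2
    · exact ⟨x, hx, hpx, hxp⟩
  by_cases h : d.2 * (y.1 - p.1) - d.1 * (y.2.1 - p.2.1) = 0
  · refine huniv (hJ.eq_univ hS hed he hd' hy hpy fun h' => hxy ?_)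
    exact eq_zero_of_det_eq_zero hde h h'
  · exact huniv (hJ.eq_univ hS hde hd' he hy hpy h)

theorem HConvex.of_ordConnected {K : Set H}
    (hK : ∀ p d, d ≠ 0 → {t | lineFrom p d t ∈ K}.OrdConnected) :
    HConvex K := by
  intro x y hxy hx hy t ht
  rw [← lineFrom_eq_add_smul_sub hxy]
  by_cases hd : ((y.1 - x.1, y.2.1 - x.2.1) : ℝ × ℝ) = 0
  · rw [hd]
    convert! hx using 1
    ext <;> simp [lineFrom]
  · refine (hK x _ hd).out (x := 0) (y := 1) ?_ ?_ ht
    · rwa [Set.mem_ofPred_eq, lineFrom_zero]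
    · rwa [Set.mem_ofPred_eq, lineFrom_eq_add_smul_sub hxy, one_smul, add_sub_cancel]

theorem volume_plane {w : H} (hw : w ≠ 0) (b : ℝ) :
    volume {x : H | w.1 * x.1 + w.2.1 * x.2.1 + w.2.2 * x.2.2 = b} = 0 := by
  let s : AffineSubspace ℝ H :=
    { carrier := {x : H | w.1 * x.1 + w.2.1 * x.2.1 + w.2.2 * x.2.2 = b}
      smul_vsub_vadd_mem' := by
        intro c x y z hx hy hz
        simp only [Set.mem_ofPred_eq] at hx hy hz
        simp only [vsub_eq_sub, vadd_eq_add, Set.mem_ofPred_eq, Prod.fst_add, Prod.snd_add,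
          Prod.smul_fst, Prod.smul_snd, Prod.fst_sub, Prod.snd_sub, smul_eq_mul]
        linear_combination c * hx - c * hy + hz }
  have hR2 : (volume : Measure (ℝ × ℝ)).IsAddHaarMeasure :=
    Measure.prod.instIsAddHaarMeasure volume volume
  have hH : (volume : Measure H).IsAddHaarMeasure :=
    Measure.prod.instIsAddHaarMeasure volume volume
  refine Measure.addHaar_affineSubspace volume s fun hs => hw ?_
  have h0 : (0 : H) ∈ s := hs ▸ AffineSubspace.mem_top ℝ H 0
  have h1 : w ∈ s := hs ▸ AffineSubspace.mem_top ℝ H w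
  have h0' : w.1 * 0 + w.2.1 * 0 + w.2.2 * 0 = b := h0
  have h1' : w.1 * w.1 + w.2.1 * w.2.1 + w.2.2 * w.2.2 = b := h1
  ext
  · change w.1 = 0
    nlinarith [sq_nonneg w.1, sq_nonneg w.2.1, sq_nonneg w.2.2]
  · change w.2.1 = 0
    nlinarith [sq_nonneg w.1, sq_nonneg w.2.1, sq_nonneg w.2.2]
  · change w.2.2 = 0
    nlinarith [sq_nonneg w.1, sq_nonneg w.2.1, sq_nonneg w.2.2]

theorem HConvex.eq_univ_of_plane_compl {K : Set H} (hK : HConvex K) {w : H} (hw : w ≠ 0) {b : ℝ}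
    (h : ∀ x : H, w.1 * x.1 + w.2.1 * x.2.1 + w.2.2 * x.2.2 ≠ b → x ∈ K) : K = Set.univ := by
  refine Set.eq_univ_of_forall fun f => by_contra fun hf => hw ?_
  have hstep : ∀ f ∉ K, ∀ d : ℝ × ℝ, ∃ t : ℝ, t ≠ 0 ∧ lineFrom f d t ∉ K := by
    intro f hf d
    by_contra! hcon
    refine hf ?_
    rw [← lineFrom_zero f d]
    exact hK.lineFrom_mem (r := -1) (t := 1) (by norm_num) (by norm_num) (hcon _ (by norm_num))
      (hcon _ (by norm_num))
  have hdir : ∀ f ∉ K, ∀ d : ℝ × ℝ,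
      w.1 * d.1 + w.2.1 * d.2 + w.2.2 * (f.1 * d.2 - f.2.1 * d.1) = 0 := by
    intro f hf d
    obtain ⟨t, ht0, ht⟩ := hstep f hf d
    have h1 := not_imp_comm.1 (h f) hf
    have h2 := not_imp_comm.1 (h _) ht
    simp only [lineFrom] at h2
    exact mul_left_cancel₀ ht0 (by linear_combination h2 - h1)
  obtain ⟨t, ht0, ht⟩ := hstep f hf (1, 0)
  have h1 := hdir f hf (1, 0)
  have h2 := hdir f hf (0, 1)
  have h3 := hdir _ ht (0, 1)
  simp only [lineFrom] at h1 h2 h3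
  have hw3 : w.2.2 = 0 := mul_left_cancel₀ ht0 (by linear_combination h3 - h2)
  rw [hw3] at h1 h2
  ext
  · simpa using h1
  · simpa using h2
  · exact hw3

theorem subset_or_subset_compl_of_disjoint_frontier {E U : Set H} (hU : Convex ℝ U)
    (h : ∀ x ∈ U, x ∉ frontier E) : U ⊆ E ∨ U ⊆ Eᶜ :=
  (hU.isPreconnected.subset_or_subset isOpen_interior isOpen_interior
    (disjoint_compl_right.mono interior_subset interior_subset)
    fun x hx => mem_interior_or_of_notMem_frontier (h x hx)).imp
    (fun h' => h'.trans interior_subset) fun h' => h'.trans interior_subset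

theorem HMono.exists_halfSpace {E : Set H} (hE : HMono E) (hne : E.Nonempty)
    (hproper : E ≠ Set.univ) : ∃ w : H, ∃ b : ℝ, w ≠ 0 ∧
      volume (symmDiff E {x | w.1 * x.1 + w.2.1 * x.2.1 + w.2.2 * x.2.2 ≤ b}) = 0 := by
  obtain ⟨w, hw, b, hb⟩ := hE.joinClosed_frontier.subset_plane isClosed_frontier
    (nonempty_frontier_iff.2 ⟨hne, hproper⟩) (fun p hp => hE.exists_lineFrom_mem_frontier hp)
    (hE.frontier_ne_univ hne)
  have hlin : IsLinearMap ℝ fun x : H => w.1 * x.1 + w.2.1 * x.2.1 + w.2.2 * x.2.2 :=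
    ⟨fun x y => by simp; ring, fun c x => by simp; ring⟩
  have hneg : ∀ x : H, (-w).1 * x.1 + (-w).2.1 * x.2.1 + (-w).2.2 * x.2.2 =
      -(w.1 * x.1 + w.2.1 * x.2.1 + w.2.2 * x.2.2) := by
    intro x; simp; ring
  have hnull := volume_plane hw b
  rcases subset_or_subset_compl_of_disjoint_frontier (E := E)
    (convex_halfSpace_lt hlin b) (fun x hx hx' => hx.ne (hb x hx')) with hlt | hlt <;>
  rcases subset_or_subset_compl_of_disjoint_frontier (E := E)
    (convex_halfSpace_gt hlin b) (fun x hx hx' => hx.ne' (hb x hx')) with hgt | hgt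
  · exact absurd (hE.1.eq_univ_of_plane_compl hw fun x hx =>
      (lt_or_gt_of_ne hx).elim (fun h => hlt h) fun h => hgt h) hproper
  · refine ⟨w, b, hw, measure_mono_null ?_ hnull⟩
    rintro x (⟨hx, hx'⟩ | ⟨hx, hx'⟩)
    · exact absurd hx (hgt (show b < _ from not_le.1 hx'))
    · exact le_antisymm hx (not_lt.1 fun h => hx' (hlt h))
  · refine ⟨-w, -b, neg_ne_zero.2 hw, measure_mono_null ?_ hnull⟩
    simp only [hneg, neg_le_neg_iff]
    rintro x (⟨hx, hx'⟩ | ⟨hx, hx'⟩)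
    · exact absurd hx (hlt (show _ < b from not_le.1 hx'))
    · exact le_antisymm (not_lt.1 fun h => hx' (hgt h)) hx
  · have h := hE.2.eq_univ_of_plane_compl hw fun x hx =>
      (lt_or_gt_of_ne hx).elim (fun h => hlt h) fun h => hgt h
    exact absurd (Set.compl_univ_iff.1 h) hne.ne_empty

/-- **Classification of precisely monotone sets.** If `E ⊆ ℍ` is precisely
monotone (for every horizontal line `L`, both `E ∩ L` and `Eᶜ ∩ L` are connected
subsets of `L`) and `E` is nonempty and proper, then `E` coincides with a
half-space up to a set of measure zero. -/
theorem statement12 (E : Set H)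
    (hmono : ∀ a b c u v : ℝ, (u, v) ≠ ((0:ℝ), (0:ℝ)) →
      ({ t : ℝ | hline a b c u v t ∈ E }).OrdConnected ∧
      ({ t : ℝ | hline a b c u v t ∉ E }).OrdConnected)
    (hne : E ≠ ∅) (hproper : E ≠ Set.univ) :
    ∃ P : Set H, IsHalfSpace P ∧ volume (symmDiff E P) = 0 := by
  have hE : HMono E :=
    ⟨HConvex.of_ordConnected fun p d hd => (hmono p.1 p.2.1 p.2.2 d.1 d.2 hd).1,
      HConvex.of_ordConnected fun p d hd => (hmono p.1 p.2.1 p.2.2 d.1 d.2 hd).2⟩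
  obtain ⟨w, b, hw, h⟩ := hE.exists_halfSpace (Set.nonempty_iff_ne_empty.2 hne) hproper
  exact ⟨_, ⟨w, b, hw, rfl⟩, h⟩
end Heis
end
end

section
/- Geometry of parallel horizontal lines: Let L₁, L₂ be horizontal lines that are parallel (L₂ = g·L₁ for some g ∈ ℍ) and have distinct projections π(L₁) ≠ π(L₂). Then: (1) for every x ∈ L₁ there is a unique point x* ∈ L₂ such that x and x* lie on a common horizontal line L(x); (2) there is a unique point m ∈ ℝ², lying on the line in ℝ² midway between the parallel lines π(L₁) and π(L₂), such that every line L(x) for x ∈ L₁ intersects the vertical fiber π⁻¹(m), and moreover every point of π⁻¹(m) lies on L(x) for some x ∈ L₁. -/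
open MeasureTheory Filter

noncomputable section

namespace Heis

/-- Left translates of a horizontal line are horizontal lines with the same direction. -/
theorem image_hmul_range_hline (g : H) (a b c u v : ℝ) :
    hmul g '' Set.range (hline a b c u v) =
      Set.range (hline (hmul g (a, b, c)).1 (hmul g (a, b, c)).2.1 (hmul g (a, b, c)).2.2 u v) := by
  rw [← Set.range_comp]
  congr 1
  funext t
  simp only [Function.comp_apply, hline, hmul, Prod.mk.injEq]
  refine ⟨by ring, by ring, by ring⟩

/-- Two points of a horizontal line lie on each other's horizontal planes. -/
theorem IsHLine.mem_horizontalPlane {ℓ : Set H} (h : IsHLine ℓ) {x y : H} (hx : x ∈ ℓ)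
    (hy : y ∈ ℓ) : y.2.2 - x.2.2 = x.1 * y.2.1 - x.2.1 * y.1 := by
  obtain ⟨a, b, c, u, v, -, rfl⟩ := h
  obtain ⟨t, rfl⟩ := hx
  obtain ⟨s, rfl⟩ := hy
  simp only [hline]
  ring

/-- Horizontal lines contain the affine line through any two of their points. -/
theorem IsHLine.add_mul_sub_mem {ℓ : Set H} (h : IsHLine ℓ) {x y : H} (hx : x ∈ ℓ)
    (hy : y ∈ ℓ) (r : ℝ) :
    (x.1 + r * (y.1 - x.1), x.2.1 + r * (y.2.1 - x.2.1), x.2.2 + r * (y.2.2 - x.2.2)) ∈ ℓ := by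
  obtain ⟨a, b, c, u, v, -, rfl⟩ := h
  obtain ⟨t, rfl⟩ := hx
  obtain ⟨s, rfl⟩ := hy
  refine ⟨t + r * (s - t), ?_⟩
  simp only [hline, Prod.mk.injEq]
  refine ⟨by ring, by ring, by ring⟩

/-- The line joining `x` to a point of its horizontal plane with a different projection. -/
theorem isHLine_range_hline_sub {x y : H} (hne : proj x ≠ proj y) :
    IsHLine (Set.range (hline x.1 x.2.1 x.2.2 (y.1 - x.1) (y.2.1 - x.2.1))) := by
  refine ⟨_, _, _, _, _, ?_, rfl⟩
  contrapose! hne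
  simp only [Prod.mk.injEq, sub_eq_zero] at hne
  simp [proj, hne.1, hne.2]

theorem left_mem_range_hline_sub (x y : H) :
    x ∈ Set.range (hline x.1 x.2.1 x.2.2 (y.1 - x.1) (y.2.1 - x.2.1)) :=
  ⟨0, by simp [hline]⟩

theorem right_mem_range_hline_sub {x y : H}
    (h : y.2.2 - x.2.2 = x.1 * y.2.1 - x.2.1 * y.1) :
    y ∈ Set.range (hline x.1 x.2.1 x.2.2 (y.1 - x.1) (y.2.1 - x.2.1)) := by
  refine ⟨1, ?_⟩
  ext <;> simp only [hline]
  · ring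
  · ring
  · linear_combination -h

/-- Planar lines with the same direction `(u, v)` coincide when the displacement of their base
points is parallel to `(u, v)`. -/
theorem cross_ne_zero_of_proj_image_ne {a b c a' b' c' u v : ℝ} (huv : (u, v) ≠ ((0 : ℝ), (0 : ℝ)))
    (h : proj '' Set.range (hline a b c u v) ≠ proj '' Set.range (hline a' b' c' u v)) :
    (a' - a) * v - (b' - b) * u ≠ 0 := by
  contrapose! h
  have hn : u ^ 2 + v ^ 2 ≠ 0 := by
    contrapose! huv
    have hu : u = 0 := by nlinarith [sq_nonneg u, sq_nonneg v]
    have hv : v = 0 := by nlinarith [sq_nonneg u, sq_nonneg v]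
    rw [hu, hv]
  obtain ⟨r, hr₁, hr₂⟩ : ∃ r : ℝ, a' - a = r * u ∧ b' - b = r * v := by
    refine ⟨((a' - a) * u + (b' - b) * v) / (u ^ 2 + v ^ 2), ?_, ?_⟩
    · field_simp
      linear_combination v * h
    · field_simp
      linear_combination -u * h
  rw [← Set.range_comp, ← Set.range_comp]
  apply Set.Subset.antisymm
  · rintro _ ⟨t, rfl⟩
    refine ⟨t - r, ?_⟩
    simp only [Function.comp_apply, hline, proj, Prod.mk.injEq]
    exact ⟨by linear_combination hr₁, by linear_combination hr₂⟩
  · rintro _ ⟨t, rfl⟩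
    refine ⟨t + r, ?_⟩
    simp only [Function.comp_apply, hline, proj, Prod.mk.injEq]
    exact ⟨by linear_combination -hr₁, by linear_combination -hr₂⟩

/-- A point is equidistant from two sets exchanged by the point reflection in it. -/
theorem dist2_eq_of_reflection {m : ℝ × ℝ} {A B : Set (ℝ × ℝ)}
    (hAB : ∀ p ∈ A, (2 * m.1 - p.1, 2 * m.2 - p.2) ∈ B)
    (hBA : ∀ p ∈ B, (2 * m.1 - p.1, 2 * m.2 - p.2) ∈ A) : dist2 m A = dist2 m B := by
  unfold dist2
  congr 1
  ext d
  constructor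
  · rintro ⟨p, hp, rfl⟩
    exact ⟨_, hAB p hp, by congr 1; ring⟩
  · rintro ⟨p, hp, rfl⟩
    exact ⟨_, hBA p hp, by congr 1; ring⟩

/-- **Geometry of parallel horizontal lines.** If `ℓ₁, ℓ₂` are parallel
horizontal lines with distinct projections then: (1) every `x ∈ ℓ₁` has a unique
partner `x* ∈ ℓ₂` lying with `x` on a common horizontal line; (2) there is a
unique point `m ∈ ℝ²`, equidistant from `π(ℓ₁)` and `π(ℓ₂)`, such that every
horizontal line meeting `ℓ₁` and `ℓ₂` meets the vertical fiber over `m`, and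
every point of that fiber lies on such a line. -/
theorem statement13 (ℓ₁ ℓ₂ : Set H) (h₁ : IsHLine ℓ₁) (h₂ : IsHLine ℓ₂)
    (hpar : ∃ g : H, ℓ₂ = (hmul g) '' ℓ₁) (hproj : proj '' ℓ₁ ≠ proj '' ℓ₂) :
    (∀ x ∈ ℓ₁, ∃! y : H, y ∈ ℓ₂ ∧ ∃ ℓ : Set H, IsHLine ℓ ∧ x ∈ ℓ ∧ y ∈ ℓ) ∧
    (∃! m : ℝ × ℝ,
      dist2 m (proj '' ℓ₁) = dist2 m (proj '' ℓ₂) ∧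
      (∀ ℓ : Set H, IsHLine ℓ → (ℓ ∩ ℓ₁).Nonempty → (ℓ ∩ ℓ₂).Nonempty →
        (ℓ ∩ { z : H | proj z = m }).Nonempty) ∧
      (∀ z : H, proj z = m →
        ∃ ℓ : Set H, IsHLine ℓ ∧ z ∈ ℓ ∧ (ℓ ∩ ℓ₁).Nonempty ∧ (ℓ ∩ ℓ₂).Nonempty)) := by
  obtain ⟨a, b, c, u, v, huv, rfl⟩ := h₁
  obtain ⟨g, rfl⟩ := hpar
  rw [image_hmul_range_hline] at hproj ⊢
  generalize (hmul g (a, b, c)).1 = a' at *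
  generalize (hmul g (a, b, c)).2.1 = b' at *
  generalize (hmul g (a, b, c)).2.2 = c' at *
  have hD := cross_ne_zero_of_proj_image_ne huv hproj
  obtain ⟨k, hk⟩ : ∃ k : ℝ,
      k * ((a' - a) * v - (b' - b) * u) = a * b' - b * a' - (c' - c) :=
    ⟨_, div_mul_cancel₀ _ hD⟩
  have hne : ∀ t s, proj (hline a b c u v t) ≠ proj (hline a' b' c' u v s) := by
    intro t s h
    simp only [proj, hline, Prod.mk.injEq] at h
    exact hD (by linear_combination u * h.2 - v * h.1)
  have hplane : ∀ t, (hline a' b' c' u v (k - t)).2.2 - (hline a b c u v t).2.2 =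
      (hline a b c u v t).1 * (hline a' b' c' u v (k - t)).2.1 -
        (hline a b c u v t).2.1 * (hline a' b' c' u v (k - t)).1 := by
    intro t
    simp only [hline]
    linear_combination hk
  have hsum : ∀ t s, (∃ ℓ : Set H, IsHLine ℓ ∧ hline a b c u v t ∈ ℓ ∧
      hline a' b' c' u v s ∈ ℓ) → s = k - t := by
    rintro t s ⟨ℓ, hℓ, hx, hy⟩
    have h := hℓ.mem_horizontalPlane hx hy
    simp only [hline] at h
    exact mul_right_cancel₀ hD (by linear_combination h - hk)
  have hjoin : ∀ t, ∃ ℓ : Set H, IsHLine ℓ ∧ hline a b c u v t ∈ ℓ ∧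
      hline a' b' c' u v (k - t) ∈ ℓ := fun t =>
    ⟨_, isHLine_range_hline_sub (hne t (k - t)), left_mem_range_hline_sub _ _,
      right_mem_range_hline_sub (hplane t)⟩
  refine ⟨?_, ((a + a' + k * u) / 2, (b + b' + k * v) / 2), ⟨?_, ?_, ?_⟩, ?_⟩
  · rintro _ ⟨t, rfl⟩
    refine ⟨hline a' b' c' u v (k - t), ⟨⟨_, rfl⟩, hjoin t⟩, ?_⟩
    rintro _ ⟨⟨s, rfl⟩, hs⟩
    rw [hsum t s hs]
  · apply dist2_eq_of_reflection
    · rintro _ ⟨_, ⟨t, rfl⟩, rfl⟩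
      refine ⟨_, ⟨k - t, rfl⟩, ?_⟩
      simp only [proj, hline, Prod.mk.injEq]
      exact ⟨by ring, by ring⟩
    · rintro _ ⟨_, ⟨t, rfl⟩, rfl⟩
      refine ⟨_, ⟨k - t, rfl⟩, ?_⟩
      simp only [proj, hline, Prod.mk.injEq]
      exact ⟨by ring, by ring⟩
  · rintro ℓ hℓ ⟨_, hx, ⟨t, rfl⟩⟩ ⟨_, hy, ⟨s, rfl⟩⟩
    obtain rfl := hsum t s ⟨ℓ, hℓ, hx, hy⟩
    refine ⟨_, hℓ.add_mul_sub_mem hx hy (1 / 2), ?_⟩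
    simp only [proj, hline, Set.mem_ofPred_eq, Prod.mk.injEq]
    exact ⟨by ring, by ring⟩
  · rintro ⟨z₁, z₂, z₃⟩ hz
    simp only [proj, Prod.mk.injEq] at hz
    obtain ⟨t, ht⟩ : ∃ t : ℝ, t * ((a' - a) * v - (b' - b) * u) =
        c + c' + k * (a' * v - b' * u) - 2 * z₃ := ⟨_, div_mul_cancel₀ _ hD⟩
    obtain ⟨ℓ, hℓ, hx, hy⟩ := hjoin t
    refine ⟨ℓ, hℓ, ?_, ⟨_, hx, t, rfl⟩, ⟨_, hy, k - t, rfl⟩⟩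
    convert hℓ.add_mul_sub_mem hx hy (1 / 2) using 1
    simp only [hline, Prod.mk.injEq]
    exact ⟨by linear_combination hz.1, by linear_combination hz.2,
      by linear_combination ht / 2⟩
  · rintro ⟨m₁, m₂⟩ ⟨-, hm, -⟩
    have hcol : ∀ t : ℝ, (m₁ - (a + a' + k * u) / 2) * (b' - b + (k - 2 * t) * v) =
        (m₂ - (b + b' + k * v) / 2) * (a' - a + (k - 2 * t) * u) := by
      intro t
      obtain ⟨_, ⟨r, rfl⟩, hr⟩ := hm _ (isHLine_range_hline_sub (hne t (k - t)))
        ⟨_, left_mem_range_hline_sub _ _, t, rfl⟩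
        ⟨_, right_mem_range_hline_sub (hplane t), k - t, rfl⟩
      simp only [proj, hline, Set.mem_ofPred_eq, Prod.mk.injEq] at hr
      obtain ⟨rfl, rfl⟩ := hr
      ring
    have h₀ := hcol (k / 2)
    have h₁ := hcol ((k - 1) / 2)
    simp only [Prod.mk.injEq]
    constructor
    · refine sub_eq_zero.1 (mul_right_cancel₀ hD ?_)
      linear_combination (a' - a) * (h₁ - h₀) - u * h₀
    · refine sub_eq_zero.1 (mul_right_cancel₀ hD ?_)
      linear_combination (b' - b) * (h₁ - h₀) - v * h₀
end Heis
end
end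

section
/- Geometry of skew horizontal lines: Let L₁ = {(t,wt,c) : t ∈ ℝ} and L₂ = {(s,−ws,−c) : s ∈ ℝ} with w, c > 0 be a pair of skew horizontal lines in normal form. Then: (1) the points p = (t,wt,c) ∈ L₁ and q = (s,−ws,−c) ∈ L₂ lie on a common horizontal line if and only if w·t·s = c; (2) the projections π(L) of the horizontal lines L meeting both L₁ and L₂ are exactly the tangent lines of the hyperbola Y = {(u,v) ∈ ℝ² : w²u² − v² = cw}, whose asymptotes are π(L₁) and π(L₂); (3) every point (t,wt,c) ∈ L₁ with t ≠ 0 lies on a unique horizontal line meeting L₂, while the point with t = 0 lies on no horizontal line meeting L₂. -/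
open MeasureTheory Filter

noncomputable section

namespace Heis

/-- Two points of a horizontal line lie in each other's horizontal planes. -/
theorem IsHLine.mem_horizontal {ℓ : Set H} (h : IsHLine ℓ) {p q : H} (hp : p ∈ ℓ)
    (hq : q ∈ ℓ) : q.2.2 = p.2.2 + p.1 * q.2.1 - p.2.1 * q.1 := by
  obtain ⟨a, b, c, u, v, -, rfl⟩ := h
  obtain ⟨x, rfl⟩ := hp
  obtain ⟨y, rfl⟩ := hq
  simp only [hline]
  ring

/-- A horizontal line does not depend on the base point and on the scaling of the direction. -/
theorem range_hline_eq (a b c u v x : ℝ) {r : ℝ} (hr : r ≠ 0) :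
    Set.range (hline (a + x * u) (b + x * v) (c + x * (a * v - b * u)) (r * u) (r * v)) =
      Set.range (hline a b c u v) := by
  ext z
  constructor
  · rintro ⟨t, rfl⟩
    refine ⟨x + t * r, ?_⟩
    simp only [hline, Prod.mk.injEq]
    refine ⟨?_, ?_, ?_⟩ <;> ring
  · rintro ⟨t, rfl⟩
    refine ⟨(t - x) / r, ?_⟩
    simp only [hline, Prod.mk.injEq]
    refine ⟨?_, ?_, ?_⟩ <;> field_simp <;> ring

/-- A horizontal line is determined by two of its points. -/
theorem IsHLine.eq_range {ℓ : Set H} (h : IsHLine ℓ) {p q : H} (hp : p ∈ ℓ) (hq : q ∈ ℓ)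
    (hpq : p ≠ q) :
    ℓ = Set.range (hline p.1 p.2.1 p.2.2 (q.1 - p.1) (q.2.1 - p.2.1)) := by
  obtain ⟨a, b, c, u, v, -, rfl⟩ := h
  obtain ⟨x, rfl⟩ := hp
  obtain ⟨y, rfl⟩ := hq
  have hxy : y - x ≠ 0 := fun hxy => hpq (by rw [sub_eq_zero.mp hxy])
  rw [← range_hline_eq a b c u v x hxy]
  simp only [hline]
  ring_nf

/-- The projection of a horizontal line is the line in the plane with the same direction. -/
theorem proj_image_range_hline {a b c u v : ℝ} (h : (u, v) ≠ ((0 : ℝ), (0 : ℝ))) :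
    proj '' Set.range (hline a b c u v) =
      { z : ℝ × ℝ | v * (z.1 - a) = u * (z.2 - b) } := by
  ext ⟨z₁, z₂⟩
  simp only [Set.mem_image, Set.exists_range_iff, proj, hline, Prod.mk.injEq, Set.mem_ofPred_eq]
  constructor
  · rintro ⟨t, rfl, rfl⟩
    ring
  · intro hz
    by_cases hu : u = 0
    · subst hu
      have hv : v ≠ 0 := by simpa using h
      refine ⟨(z₂ - b) / v, ?_, ?_⟩
      · have : z₁ - a = 0 := by simpa [hv] using hz
        linarith
      · field_simp
        ring
    · refine ⟨(z₁ - a) / u, ?_, ?_⟩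
      · field_simp
        ring
      · field_simp
        linarith

/-- The horizontal line through `(t, wt, c)` and `(s, −ws, −c)` when `wts = c`. -/
def nfLine (w c t s : ℝ) : Set H :=
  Set.range (hline t (w * t) c (s - t) (-(w * s) - w * t))

section NormalForm

variable {w c t s : ℝ}

theorem nf_direction_ne_zero (hc : 0 < c) (h : w * t * s = c) :
    (s - t, -(w * s) - w * t) ≠ ((0 : ℝ), (0 : ℝ)) := by
  intro h₀
  obtain ⟨h₁, h₂⟩ := Prod.mk.inj h₀
  obtain rfl : s = t := by linarith
  have h₃ : w * s = 0 := by linarith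
  rw [h₃, zero_mul] at h
  exact hc.ne h

theorem isHLine_nfLine (hc : 0 < c) (h : w * t * s = c) :
    IsHLine (nfLine w c t s) :=
  ⟨_, _, _, _, _, nf_direction_ne_zero hc h, rfl⟩

theorem left_mem_nfLine : ((t, w * t, c) : H) ∈ nfLine w c t s :=
  ⟨0, by simp [hline]⟩

theorem right_mem_nfLine (h : w * t * s = c) : ((s, -(w * s), -c) : H) ∈ nfLine w c t s := by
  refine ⟨1, ?_⟩
  simp only [hline, Prod.mk.injEq]
  refine ⟨by ring, by ring, ?_⟩
  linear_combination -2 * h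

theorem IsHLine.nf_mul_eq {ℓ : Set H} (hℓ : IsHLine ℓ) (h₁ : ((t, w * t, c) : H) ∈ ℓ)
    (h₂ : ((s, -(w * s), -c) : H) ∈ ℓ) : w * t * s = c := by
  have := hℓ.mem_horizontal h₁ h₂
  dsimp only at this
  linarith

theorem IsHLine.eq_nfLine (hc : 0 < c) {ℓ : Set H} (hℓ : IsHLine ℓ)
    (h₁ : ((t, w * t, c) : H) ∈ ℓ) (h₂ : ((s, -(w * s), -c) : H) ∈ ℓ) :
    ℓ = nfLine w c t s := by
  refine hℓ.eq_range h₁ h₂ fun h => ?_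
  have := congrArg (fun p : H => p.2.2) h
  dsimp only at this
  linarith

theorem proj_image_nfLine (hw : 0 < w) (hc : 0 < c) (h : w * t * s = c) :
    proj '' nfLine w c t s =
      { z : ℝ × ℝ | w ^ 2 * ((t + s) / 2) * z.1 - w * (t - s) / 2 * z.2 = c * w } := by
  rw [nfLine, proj_image_range_hline (nf_direction_ne_zero hc h)]
  ext ⟨x, y⟩
  simp only [Set.mem_ofPred_eq]
  constructor
  · intro hz
    linear_combination w * h - w / 2 * hz
  · intro hz
    apply mul_left_cancel₀ hw.ne'
    linear_combination 2 * w * h - 2 * hz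

end NormalForm

/-- **Geometry of skew horizontal lines.** For the normal-form pair
`L₁ = {(t,wt,c)}`, `L₂ = {(s,−ws,−c)}` with `w, c > 0`: (1) `(t,wt,c)` and
`(s,−ws,−c)` lie on a common horizontal line iff `wts = c`; (2) the projections
of horizontal lines meeting both `L₁` and `L₂` are exactly the tangent lines of
the hyperbola `w²u² − v² = cw`; (3) every point of `L₁` with `t ≠ 0` lies on a
unique horizontal line meeting `L₂`, and the point with `t = 0` lies on none. -/
theorem statement14 (w c : ℝ) (hw : 0 < w) (hc : 0 < c) :
    (∀ t s : ℝ,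
      (∃ ℓ : Set H, IsHLine ℓ ∧ ((t, w * t, c) : H) ∈ ℓ ∧ ((s, -(w * s), -c) : H) ∈ ℓ)
        ↔ w * t * s = c) ∧
    (∀ ℓ : Set H, IsHLine ℓ → (ℓ ∩ nf₁ w c).Nonempty → (ℓ ∩ nf₂ w c).Nonempty →
      ∃ u₀ v₀ : ℝ, w ^ 2 * u₀ ^ 2 - v₀ ^ 2 = c * w ∧
        proj '' ℓ = { z : ℝ × ℝ | w ^ 2 * u₀ * z.1 - v₀ * z.2 = c * w }) ∧
    (∀ u₀ v₀ : ℝ, w ^ 2 * u₀ ^ 2 - v₀ ^ 2 = c * w →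
      ∃ ℓ : Set H, IsHLine ℓ ∧ (ℓ ∩ nf₁ w c).Nonempty ∧ (ℓ ∩ nf₂ w c).Nonempty ∧
        proj '' ℓ = { z : ℝ × ℝ | w ^ 2 * u₀ * z.1 - v₀ * z.2 = c * w }) ∧
    (∀ t : ℝ, t ≠ 0 →
      ∃! ℓ : Set H, IsHLine ℓ ∧ ((t, w * t, c) : H) ∈ ℓ ∧ (ℓ ∩ nf₂ w c).Nonempty) ∧
    (¬ ∃ ℓ : Set H, IsHLine ℓ ∧ (((0:ℝ), (0:ℝ), c) : H) ∈ ℓ ∧ (ℓ ∩ nf₂ w c).Nonempty) := by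
  refine ⟨fun t s => ⟨?_, fun h => ?_⟩, ?_, fun u₀ v₀ h => ?_, fun t ht => ?_, ?_⟩
  · rintro ⟨ℓ, hℓ, h₁, h₂⟩
    exact hℓ.nf_mul_eq h₁ h₂
  · exact ⟨_, isHLine_nfLine hc h, left_mem_nfLine, right_mem_nfLine h⟩
  · rintro ℓ hℓ ⟨_, h₁, t, rfl⟩ ⟨_, h₂, s, rfl⟩
    have h := hℓ.nf_mul_eq h₁ h₂
    refine ⟨(t + s) / 2, w * (t - s) / 2, by linear_combination w * h, ?_⟩
    rw [hℓ.eq_nfLine hc h₁ h₂, proj_image_nfLine hw hc h]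
  · have hts : w * (u₀ + v₀ / w) * (u₀ - v₀ / w) = c := by
      field_simp
      linear_combination h
    refine ⟨_, isHLine_nfLine hc hts, ⟨_, left_mem_nfLine, _, rfl⟩,
      ⟨_, right_mem_nfLine hts, _, rfl⟩, ?_⟩
    rw [proj_image_nfLine hw hc hts]
    have hu : (u₀ + v₀ / w + (u₀ - v₀ / w)) / 2 = u₀ := by ring
    have hv : w * (u₀ + v₀ / w - (u₀ - v₀ / w)) / 2 = v₀ := by
      field_simp
      ring
    rw [hu, hv]
  · have hs : w * t * (c / (w * t)) = c := mul_div_cancel₀ c (mul_ne_zero hw.ne' ht)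
    refine ⟨nfLine w c t (c / (w * t)), ⟨isHLine_nfLine hc hs, left_mem_nfLine,
      ⟨_, right_mem_nfLine hs, _, rfl⟩⟩, ?_⟩
    rintro ℓ ⟨hℓ, h₁, _, h₂, s, rfl⟩
    have h := hℓ.nf_mul_eq h₁ h₂
    rw [hℓ.eq_nfLine hc h₁ h₂,
      mul_left_cancel₀ (mul_ne_zero hw.ne' ht) (h.trans hs.symm)]
  · rintro ⟨ℓ, hℓ, h₁, _, h₂, s, rfl⟩
    have h := hℓ.nf_mul_eq (w := w) (t := 0) (by simpa using h₁) h₂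
    simp only [mul_zero, zero_mul] at h
    exact hc.ne h
end Heis
end
end

section
/- Symmetric transversals of skew lines are parallel with common fiber over the origin: Let L₁ = {(t,wt,c) : t ∈ ℝ} and L₂ = {(s,−ws,−c) : s ∈ ℝ} with w, c > 0 be skew horizontal lines in normal form. For t ≠ 0 let x = (t,wt,c) and x̂ = (−t,−wt,c), and let L(x), L(x̂) be the unique horizontal lines through x, respectively x̂, meeting L₂. Then L(x) and L(x̂) are parallel horizontal lines with distinct projections, and the point m(L(x),L(x̂)) ∈ ℝ² associated to this parallel pair equals (0,0). -/
open MeasureTheory Filter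

noncomputable section

namespace Heis

/-- The height difference of two points of a horizontal line, in terms of their projections. -/
theorem IsHLine.height_eq {ℓ : Set H} (hℓ : IsHLine ℓ) {p q : H} (hp : p ∈ ℓ) (hq : q ∈ ℓ) :
    q.2.2 = p.2.2 + p.1 * q.2.1 - p.2.1 * q.1 := by
  obtain ⟨a, b, e, u, v, -, rfl⟩ := hℓ
  obtain ⟨T, rfl⟩ := hp
  obtain ⟨S, rfl⟩ := hq
  simp only [hline]
  ring

/-- A horizontal line is determined by two of its points. -/
theorem IsHLine.eq_range_hline {ℓ : Set H} (hℓ : IsHLine ℓ) {p q : H} (hp : p ∈ ℓ) (hq : q ∈ ℓ)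
    (hpq : p ≠ q) :
    ℓ = Set.range (hline p.1 p.2.1 p.2.2 (q.1 - p.1) (q.2.1 - p.2.1)) := by
  obtain ⟨a, b, e, u, v, -, rfl⟩ := hℓ
  obtain ⟨T, rfl⟩ := hp
  obtain ⟨S, rfl⟩ := hq
  have hST : S - T ≠ 0 := fun h => hpq (by rw [sub_eq_zero.mp h])
  ext z
  constructor
  · rintro ⟨R, rfl⟩
    refine ⟨(R - T) / (S - T), ?_⟩
    simp only [hline, Prod.mk.injEq]
    refine ⟨?_, ?_, ?_⟩ <;> field_simp <;> ring
  · rintro ⟨R, rfl⟩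
    refine ⟨T + R * (S - T), ?_⟩
    simp only [hline, Prod.mk.injEq]
    refine ⟨?_, ?_, ?_⟩ <;> ring

/-- If two points of a horizontal line have the same height and antipodal projections,
then the line meets the vertical fiber over the origin. -/
theorem IsHLine.inter_fiber_nonempty {ℓ : Set H} (hℓ : IsHLine ℓ) {a b e : ℝ}
    (hp : ((a, b, e) : H) ∈ ℓ) (hq : ((-a, -b, e) : H) ∈ ℓ) :
    (ℓ ∩ { z : H | proj z = ((0:ℝ), (0:ℝ)) }).Nonempty := by
  obtain ⟨a₀, b₀, e₀, u, v, -, rfl⟩ := hℓ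
  obtain ⟨T, hT⟩ := hp
  obtain ⟨S, hS⟩ := hq
  simp only [hline, Prod.mk.injEq] at hT hS
  refine ⟨_, ⟨(T + S) / 2, rfl⟩, ?_⟩
  simp only [hline, proj, Set.mem_ofPred_eq, Prod.mk.injEq]
  constructor
  · linear_combination (hT.1 + hS.1) / 2
  · linear_combination (hT.2.1 + hS.2.1) / 2

/-- The transversal from `(t, wt, c)` to the second line of the normal form meets it at
`(s, -ws, -c)`, where `wts = c`. -/
theorem IsHLine.eq_transversal {w c t s : ℝ} (hc : 0 < c) (hs : w * t * s = c)
    {ℓ : Set H} (hℓ : IsHLine ℓ) (hx : ((t, w * t, c) : H) ∈ ℓ) (hm : (ℓ ∩ nf₂ w c).Nonempty) :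
    ℓ = Set.range (fun r : ℝ =>
      ((t + r * (s - t), w * t - r * (w * (s + t)), c - 2 * c * r) : H)) := by
  obtain ⟨_, hy, s', rfl⟩ := hm
  have h := hℓ.height_eq hx hy
  have hwt : w * t ≠ 0 := left_ne_zero_of_mul (hs ▸ hc.ne')
  have hss : s' = s := mul_left_cancel₀ hwt (by linear_combination h / 2 - hs)
  subst hss
  have hne : ((t, w * t, c) : H) ≠ (s', -(w * s'), -c) := by
    intro h
    simp only [Prod.mk.injEq] at h
    linarith [h.2.2]
  rw [hℓ.eq_range_hline hx hy hne]
  congr 1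
  funext r
  simp only [hline, Prod.mk.injEq]
  refine ⟨trivial, by ring, by linear_combination -2 * r * hs⟩

/-- **Symmetric transversals of skew lines are parallel with common fiber over
the origin.** For the normal-form skew pair `L₁ = {(t,wt,c)}`, `L₂ = {(s,−ws,−c)}`
with `w,c > 0`, and `t ≠ 0`, let `ℓ` (resp. `ℓ'`) be a horizontal line through
`x = (t,wt,c)` (resp. `x̂ = (−t,−wt,c)`) which meets `L₂`.  Then `ℓ` and `ℓ'`
are parallel with distinct projections, and the associated point `m(ℓ,ℓ')`
equals `(0,0)`: every horizontal line meeting both `ℓ` and `ℓ'` meets the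
vertical fiber over `(0,0)`, and every point of that fiber lies on such a line. -/
theorem statement15 (w c t : ℝ) (hw : 0 < w) (hc : 0 < c) (ht : t ≠ 0)
    (ℓ ℓ' : Set H) (hℓ : IsHLine ℓ) (hℓ' : IsHLine ℓ')
    (hx : ((t, w * t, c) : H) ∈ ℓ) (hm : (ℓ ∩ nf₂ w c).Nonempty)
    (hx' : ((-t, -(w * t), c) : H) ∈ ℓ') (hm' : (ℓ' ∩ nf₂ w c).Nonempty) :
    (∃ g : H, ℓ' = (hmul g) '' ℓ) ∧ proj '' ℓ ≠ proj '' ℓ' ∧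
    (∀ ℓ'' : Set H, IsHLine ℓ'' → (ℓ'' ∩ ℓ).Nonempty → (ℓ'' ∩ ℓ').Nonempty →
      (ℓ'' ∩ { z : H | proj z = ((0:ℝ), (0:ℝ)) }).Nonempty) ∧
    (∀ z : H, proj z = ((0:ℝ), (0:ℝ)) →
      ∃ ℓ'' : Set H, IsHLine ℓ'' ∧ z ∈ ℓ'' ∧ (ℓ'' ∩ ℓ).Nonempty ∧ (ℓ'' ∩ ℓ').Nonempty) := by
  obtain ⟨s, hs⟩ : ∃ s, w * t * s = c := ⟨c / (w * t), by field_simp⟩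
  have hE := hℓ.eq_transversal hc hs hx hm
  have hE' := hℓ'.eq_transversal (w := w) (t := -t) (s := -s) hc (by linear_combination hs)
    (by simpa only [mul_neg] using hx') hm'
  refine ⟨⟨(-2 * t, -2 * (w * t), 0), ?_⟩, ?_, ?_, ?_⟩
  · subst hE hE'
    have hg : ∀ r : ℝ, hmul (-2 * t, -2 * (w * t), 0)
        (t + r * (s - t), w * t - r * (w * (s + t)), c - 2 * c * r) =
        (-t + -r * (-s - -t), w * -t - -r * (w * (-s + -t)), c - 2 * c * -r) := by
      intro r
      simp only [hmul, Prod.mk.injEq]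
      refine ⟨by ring, by ring, by linear_combination 4 * r * hs⟩
    ext z
    constructor
    · rintro ⟨r, rfl⟩
      exact ⟨_, ⟨-r, rfl⟩, by simpa only [neg_neg] using hg (-r)⟩
    · rintro ⟨_, ⟨r, rfl⟩, rfl⟩
      exact ⟨-r, (hg r).symm⟩
  · intro h
    have hmem : ((t, w * t) : ℝ × ℝ) ∈ proj '' ℓ' := h ▸ ⟨_, hx, rfl⟩
    rw [hE'] at hmem
    obtain ⟨_, ⟨r, rfl⟩, hr⟩ := hmem
    simp only [proj, Prod.mk.injEq] at hr
    obtain ⟨h1, h2⟩ := hr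
    have : c = 0 := by
      linear_combination (-(w * (s + t)) / 4) * h1 - ((s - t) / 4) * h2 - hs
    exact hc.ne' this
  · rintro m hmL ⟨p, hpm, hp⟩ ⟨q, hqm, hq⟩
    rw [hE] at hp
    rw [hE'] at hq
    obtain ⟨r, rfl⟩ := hp
    obtain ⟨r', rfl⟩ := hq
    have h := hmL.height_eq hpm hqm
    have hrr : r' = r := mul_left_cancel₀ hc.ne' (by
      linear_combination -h / 4 - (r' - r) / 2 * hs)
    subst hrr
    refine hmL.inter_fiber_nonempty hpm ?_
    convert hqm using 3 <;> ring
  · rintro ⟨z₁, z₂, z₃⟩ hz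
    simp only [proj, Prod.mk.injEq] at hz
    obtain ⟨rfl, rfl⟩ := hz
    obtain ⟨r, rfl⟩ : ∃ r, z₃ = c - 2 * c * r := ⟨(c - z₃) / (2 * c), by field_simp; ring⟩
    refine ⟨Set.range (hline 0 0 (c - 2 * c * r) (t + r * (s - t)) (w * t - r * (w * (s + t)))),
      ⟨_, _, _, _, _, ?_, rfl⟩, ⟨0, by simp [hline]⟩,
      ⟨_, ⟨1, rfl⟩, hE ▸ ⟨r, by simp [hline]⟩⟩, ⟨_, ⟨-1, rfl⟩, hE' ▸ ⟨r, ?_⟩⟩⟩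
    · intro h
      simp only [Prod.mk.injEq] at h
      obtain ⟨h1, h2⟩ := h
      have : c = 0 := by
        linear_combination (w * (s + t) / 2) * h1 + ((s - t) / 2) * h2 - hs
      exact hc.ne' this
    · simp only [hline, Prod.mk.injEq]
      refine ⟨by ring, by ring, by ring⟩
end Heis
end
end
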